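/- arXiv:2107.11841 — 2 statements merged into one kernel-verified Lean document; each statement's English description precedes it below -/
import Mathlib

section
/- The HyperLTL model checking problem is decidable: there is an algorithm that, given a finite Kripke structure K and a HyperLTL sentence φ, decides whether K ⊨ φ. -/
/-!
STATEMENT 0: The HyperLTL model checking problem is decidable: there is an
algorithm that, given a finite Kripke structure K and a HyperLTL sentence φ,
decides whether K ⊨ φ.
-/

/-- A trace over the atomic propositions (drawn from `ℕ`). -/
abbrev Trace : Type := ℕ → Set ℕ

/-- Quantifier-free HyperLTL formulas: `a_π | ¬ψ | ψ ∧ ψ | X ψ | ψ U ψ`. -/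
inductive QF : Type
  | atom : ℕ → ℕ → QF            -- `a_π` (proposition, trace variable)
  | not : QF → QF
  | and : QF → QF → QF
  | next : QF → QF
  | xuntil : QF → QF → QF

/-- Satisfaction of a quantifier-free formula w.r.t. a trace assignment `Pi`
and a position `i`. -/
def QF.Sat (Pi : ℕ → Trace) : ℕ → QF → Prop
  | i, .atom a π => a ∈ Pi π i
  | i, .not ψ => ¬ QF.Sat Pi i ψ
  | i, .and ψ₁ ψ₂ => QF.Sat Pi i ψ₁ ∧ QF.Sat Pi i ψ₂
  | i, .next ψ => QF.Sat Pi (i + 1) ψ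
  | i, .xuntil ψ₁ ψ₂ =>
      ∃ k, i ≤ k ∧ QF.Sat Pi k ψ₂ ∧ ∀ j, i ≤ j → j < k → QF.Sat Pi j ψ₁

/-- Trace variables occurring in a quantifier-free formula. -/
def QF.vars : QF → Finset ℕ
  | .atom _ π => {π}
  | .not ψ => ψ.vars
  | .and ψ₁ ψ₂ => ψ₁.vars ∪ ψ₂.vars
  | .next ψ => ψ.vars
  | .xuntil ψ₁ ψ₂ => ψ₁.vars ∪ ψ₂.vars

/-- HyperLTL formulas: a block of trace quantifiers followed by a
quantifier-free formula. -/
inductive HyperLTL : Type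
  | qf : QF → HyperLTL
  | ex : ℕ → HyperLTL → HyperLTL
  | all : ℕ → HyperLTL → HyperLTL

/-- Satisfaction `T, Π, i ⊨ φ` of a HyperLTL formula over a set of traces `T`. -/
def HyperLTL.Sat (T : Set Trace) : (ℕ → Trace) → ℕ → HyperLTL → Prop
  | Pi, i, .qf ψ => QF.Sat Pi i ψ
  | Pi, i, .ex π φ => ∃ t ∈ T, HyperLTL.Sat T (Function.update Pi π t) i φ
  | Pi, i, .all π φ => ∀ t ∈ T, HyperLTL.Sat T (Function.update Pi π t) i φ

/-- Free trace variables of a HyperLTL formula. -/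
def HyperLTL.free : HyperLTL → Finset ℕ
  | .qf ψ => ψ.vars
  | .ex π φ => φ.free \ {π}
  | .all π φ => φ.free \ {π}

/-- A HyperLTL sentence is a closed formula. -/
def HyperLTL.Closed (φ : HyperLTL) : Prop := φ.free = ∅

/-- `T ⊨ φ` iff `T, ∅, 0 ⊨ φ`. -/
def TSat (T : Set Trace) (φ : HyperLTL) : Prop :=
  HyperLTL.Sat T (fun _ _ => (∅ : Set ℕ)) 0 φ

/-- A finite Kripke structure: finitely many states `Fin n`, an initial state,
a transition function with nonempty successor sets, and a state labeling. -/
structure FinKripke where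
  n : ℕ
  init : Fin n
  trans : Fin n → Finset (Fin n)
  trans_nonempty : ∀ s, (trans s).Nonempty
  label : Fin n → Finset ℕ

/-- Paths of a finite Kripke structure starting in the initial state. -/
def FinKripke.IsPath (K : FinKripke) (p : ℕ → Fin K.n) : Prop :=
  p 0 = K.init ∧ ∀ i, p (i + 1) ∈ K.trans (p i)

/-- The set of traces of paths of `K` starting in the initial state. -/
def FinKripke.Traces (K : FinKripke) : Set Trace :=
  { t | ∃ p, K.IsPath p ∧ t = fun i => ((K.label (p i) : Finset ℕ) : Set ℕ) }

/-- `K ⊨ φ` iff `Tr(K, s₀) ⊨ φ`. -/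
def FinKripke.Models (K : FinKripke) (φ : HyperLTL) : Prop :=
  TSat K.Traces φ

/-- An explicit (injective) numerical encoding of quantifier-free formulas. -/
def QF.enc : QF → ℕ
  | .atom a π => Nat.pair 0 (Nat.pair a π)
  | .not ψ => Nat.pair 1 ψ.enc
  | .and ψ₁ ψ₂ => Nat.pair 2 (Nat.pair ψ₁.enc ψ₂.enc)
  | .next ψ => Nat.pair 3 ψ.enc
  | .xuntil ψ₁ ψ₂ => Nat.pair 4 (Nat.pair ψ₁.enc ψ₂.enc)

/-- An explicit (injective) numerical encoding of HyperLTL formulas. -/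
def HyperLTL.enc : HyperLTL → ℕ
  | .qf ψ => Nat.pair 0 ψ.enc
  | .ex π φ => Nat.pair 1 (Nat.pair π φ.enc)
  | .all π φ => Nat.pair 2 (Nat.pair π φ.enc)

/-- An explicit (injective) numerical encoding of finite Kripke structures. -/
def FinKripke.enc (K : FinKripke) : ℕ :=
  Nat.pair K.n (Nat.pair K.init.val (Nat.pair
    (Encodable.encode
      ((List.finRange K.n).map fun s => ((K.trans s).sort (· ≤ ·)).map Fin.val))
    (Encodable.encode
      ((List.finRange K.n).map fun s => (K.label s).sort (· ≤ ·)))))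


namespace HMC

/-! ### Basic computable primitives -/

def bex (n : ℕ) (f : ℕ → Bool) : Bool := Nat.rec false (fun i r => r || f i) n

def ball (n : ℕ) (f : ℕ → Bool) : Bool := Nat.rec true (fun i r => r && f i) n

/-- The number whose binary digits below `n` are given by `f`. -/
def mk (n : ℕ) (f : ℕ → Bool) : ℕ := Nat.rec 0 (fun i r => r + cond (f i) (2 ^ i) 0) n

def bit (x i : ℕ) : Bool := decide (x / 2 ^ i % 2 = 1)

def tab {β : Type} (n : ℕ) (f : ℕ → β) : List β := (List.range n).map f

theorem bex_iff {n : ℕ} {f : ℕ → Bool} : bex n f = true ↔ ∃ i < n, f i = true := by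
  induction n with
  | zero => simp [bex]
  | succ n ih =>
    have : bex (n + 1) f = (bex n f || f n) := rfl
    rw [this, Bool.or_eq_true, ih]
    constructor
    · rintro (⟨i, h, h'⟩ | h)
      · exact ⟨i, by omega, h'⟩
      · exact ⟨n, by omega, h⟩
    · rintro ⟨i, h, h'⟩
      rcases Nat.lt_succ_iff_lt_or_eq.1 h with h1 | rfl
      · exact Or.inl ⟨i, h1, h'⟩
      · exact Or.inr h'

theorem ball_iff {n : ℕ} {f : ℕ → Bool} : ball n f = true ↔ ∀ i < n, f i = true := by
  induction n with
  | zero => simp [ball]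
  | succ n ih =>
    have : ball (n + 1) f = (ball n f && f n) := rfl
    rw [this, Bool.and_eq_true, ih]
    constructor
    · rintro ⟨h, h'⟩ i hi
      rcases Nat.lt_succ_iff_lt_or_eq.1 hi with h1 | rfl
      · exact h i h1
      · exact h'
    · intro h
      exact ⟨fun i hi => h i (by omega), h n (by omega)⟩

theorem mk_lt (n : ℕ) (f : ℕ → Bool) : mk n f < 2 ^ n := by
  induction n with
  | zero => simp [mk]
  | succ n ih =>
    have : mk (n + 1) f = mk n f + cond (f n) (2 ^ n) 0 := rfl
    rw [this, pow_succ]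
    cases f n <;> simp <;> omega

theorem bit_eq_testBit (x i : ℕ) : bit x i = x.testBit i := by
  rw [bit, Nat.testBit_eq_decide_div_mod_eq]

theorem bit_mk {n : ℕ} {f : ℕ → Bool} {i : ℕ} (hi : i < n) : bit (mk n f) i = f i := by
  rw [bit_eq_testBit]
  induction n with
  | zero => omega
  | succ n ih =>
    have e : mk (n + 1) f = mk n f + cond (f n) (2 ^ n) 0 := rfl
    have hl := mk_lt n f
    rw [e]
    rcases Nat.lt_succ_iff_lt_or_eq.1 hi with h1 | rfl
    · rw [← ih h1]
      cases f n
      · simp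
      · simp only [cond_true]
        rw [add_comm, Nat.testBit_two_pow_add_gt h1]
    · cases h : f i
      · simp [Nat.testBit_lt_two_pow hl]
      · simp only [cond_true]
        rw [add_comm, Nat.testBit_two_pow_add_eq, Nat.testBit_lt_two_pow hl]; rfl

theorem mk_congr {n : ℕ} {f g : ℕ → Bool} (h : ∀ i < n, f i = g i) : mk n f = mk n g := by
  induction n with
  | zero => rfl
  | succ n ih =>
    have e (f) : mk (n + 1) f = mk n f + cond (f n) (2 ^ n) 0 := rfl
    rw [e, e, ih (fun i hi => h i (by omega)), h n (by omega)]

theorem mk_congr' {n : ℕ} {f g : ℕ → Bool} (h : ∀ i < n, (f i = true ↔ g i = true)) :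
    mk n f = mk n g :=
  mk_congr fun i hi => Bool.eq_iff_iff.2 (h i hi)

theorem getD_tab {β : Type} {n : ℕ} {f : ℕ → β} {i : ℕ} (d : β) (hi : i < n) :
    (tab n f).getD i d = f i := by
  simp [tab, List.getD, hi]

theorem pair_lt {a b n m : ℕ} (ha : a < n) (hb : b < m) : Nat.pair a b < Nat.pair n m :=
  (Nat.pair_lt_pair_left b ha).trans (Nat.pair_lt_pair_right n hb)

/-! ### Ramsey -/

theorem ramsey (N : ℕ) (col : ℕ → ℕ → ℕ) (h : ∀ i j, i < j → col i j < N) :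
    ∃ (g : ℕ → ℕ) (c : ℕ), StrictMono g ∧ ∀ i j, i < j → col (g i) (g j) = c := by
  classical
  have fin : ∀ (f : ℕ → ℕ), (∀ᶠ j in (Filter.hyperfilter ℕ : Filter ℕ), f j < N) →
      ∃ c, ∀ᶠ j in (Filter.hyperfilter ℕ : Filter ℕ), f j = c := by
    intro f hf
    have h2 : (⋃ c ∈ Set.Iio N, {j | f j = c}) ∈ Filter.hyperfilter ℕ := by
      filter_upwards [hf] with j hj
      simpa using hj
    rw [Ultrafilter.finite_biUnion_mem_iff (Set.finite_Iio N)] at h2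
    obtain ⟨c, -, hc⟩ := h2
    exact ⟨c, hc⟩
  have gt : ∀ i : ℕ, ∀ᶠ j in (Filter.hyperfilter ℕ : Filter ℕ), i < j := by
    intro i
    have h1 : ∀ᶠ j in (Filter.cofinite : Filter ℕ), i < j := by
      rw [Nat.cofinite_eq_atTop]
      exact Filter.eventually_gt_atTop i
    exact h1.filter_mono Filter.hyperfilter_le_cofinite
  have h1 : ∀ i, ∃ c, ∀ᶠ j in (Filter.hyperfilter ℕ : Filter ℕ), col i j = c := fun i =>
    fin _ ((gt i).mono fun j hj => h i j hj)
  choose k hk using h1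
  have hkN : ∀ i, k i < N := fun i => by
    obtain ⟨j, hj, hj'⟩ := ((hk i).and (gt i)).exists
    rw [← hj]; exact h i j hj'
  obtain ⟨c, hc⟩ := fin k (Filter.Eventually.of_forall hkN)
  obtain ⟨g, -, hg⟩ := exists_seq_of_forall_finset_exists (fun i => k i = c)
    (fun x y => x < y ∧ col x y = c) (by
      intro s hs
      have : ∀ᶠ y in (Filter.hyperfilter ℕ : Filter ℕ), ∀ x ∈ s, x < y ∧ col x y = c := by
        rw [Filter.eventually_all_finset]
        intro x hx
        filter_upwards [hk x, gt x] with y h1 h2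
        exact ⟨h2, by rw [h1, hs x hx]⟩
      exact (hc.and this).exists)
  exact ⟨g, c, strictMono_nat_of_lt_succ fun i => (hg i (i + 1) (by omega)).1,
    fun i j hij => (hg i j hij).2⟩

/-! ### Recognition of languages of infinite words by finite multiplication tables -/

structure Recog (B m : ℕ) (mul : ℕ → ℕ → ℕ) (h : ℕ → ℕ) (P : ℕ → ℕ → Bool)
    (L : (ℕ → ℕ) → Prop) (V : (ℕ → ℕ) → ℕ → ℕ → ℕ) : Prop where
  lt : ∀ w, (∀ t, w t < B) → ∀ i j, i < j → V w i j < m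
  letter : ∀ w, (∀ t, w t < B) → ∀ i, V w i (i + 1) = h (w i)
  mult : ∀ w, (∀ t, w t < B) → ∀ i j k, i < j → j < k → V w i k = mul (V w i j) (V w j k)
  acc : ∀ w, (∀ t, w t < B) → ∀ s e c, StrictMono c → 0 < c 0 → (∀ i, V w 0 (c i) = s) →
    (∀ i j, i < j → V w (c i) (c j) = e) → (L w ↔ P s e = true)

variable {B m : ℕ} {mul : ℕ → ℕ → ℕ} {h : ℕ → ℕ} {P : ℕ → ℕ → Bool}
  {L : (ℕ → ℕ) → Prop} {V : (ℕ → ℕ) → ℕ → ℕ → ℕ}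

theorem Recog.loc (H : Recog B m mul h P L V) {w w' : ℕ → ℕ} (hw : ∀ t, w t < B)
    (hw' : ∀ t, w' t < B) {i j : ℕ} (hij : i < j) (e : ∀ t, i ≤ t → t < j → w t = w' t) :
    V w i j = V w' i j := by
  obtain ⟨d, rfl⟩ : ∃ d, j = i + 1 + d := ⟨j - (i + 1), by omega⟩
  induction d with
  | zero => rw [add_zero, H.letter w hw, H.letter w' hw', e i le_rfl (by omega)]
  | succ d ih =>
    have a : i < i + 1 + d := by omega
    have b : i + 1 + d < i + 1 + (d + 1) := by omega
    rw [H.mult w hw i _ _ a b, H.mult w' hw' i _ _ a b,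
      ih a (fun t h1 h2 => e t h1 (by omega)),
      show i + 1 + (d + 1) = (i + 1 + d) + 1 from rfl, H.letter w hw, H.letter w' hw',
      e _ (by omega) (by omega)]

/-- Ramsey factorization, below given cuts `c` and with an auxiliary finite colouring `p`. -/
theorem Recog.fact (H : Recog B m mul h P L V) {w : ℕ → ℕ} (hw : ∀ t, w t < B)
    {n : ℕ} (p : ℕ → ℕ) (hp : ∀ t, p t < n) (c : ℕ → ℕ) (hc : StrictMono c) (h0 : 0 < c 0) :
    ∃ (g : ℕ → ℕ) (s e q : ℕ), StrictMono g ∧ (∀ i, V w 0 (c (g i)) = s) ∧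
      (∀ i j, i < j → V w (c (g i)) (c (g j)) = e) ∧ (∀ i, p (c (g i)) = q) := by
  obtain ⟨g, k, hg, hk⟩ := ramsey (Nat.pair m n)
    (fun i j => Nat.pair (V w (c i) (c j)) (p (c i)))
    (fun i j hij => pair_lt (H.lt w hw _ _ (hc hij)) (hp _))
  have h1 : ∀ i j, i < j → V w (c (g i)) (c (g j)) = k.unpair.1 := fun i j hij => by
    rw [← hk i j hij]; simp
  have h2 : ∀ i, p (c (g i)) = k.unpair.2 := fun i => by
    rw [← hk i (i + 1) (by omega)]; simp
  refine ⟨fun i => g (i + 1), mul (V w 0 (c (g 0))) k.unpair.1, k.unpair.1, k.unpair.2,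
    fun i j hij => hg (by omega), fun i => ?_, fun i j hij => h1 _ _ (by omega), fun i => h2 _⟩
  have hpos : 0 < c (g 0) := lt_of_lt_of_le h0 (hc.monotone (Nat.zero_le _))
  rw [H.mult w hw 0 (c (g 0)) _ hpos (hc (hg (by omega))), h1 0 (i + 1) (by omega)]

theorem Recog.compl (H : Recog B m mul h P L V) :
    Recog B m mul h (fun s e => !P s e) (fun w => ¬ L w) V where
  lt := H.lt
  letter := H.letter
  mult := H.mult
  acc w hw s e c h1 h2 h3 h4 := by
    have := H.acc w hw s e c h1 h2 h3 h4
    simp [this]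

theorem Recog.congr (H : Recog B m mul h P L V) {L' : (ℕ → ℕ) → Prop}
    (e : ∀ w, (∀ t, w t < B) → (L w ↔ L' w)) : Recog B m mul h P L' V where
  lt := H.lt
  letter := H.letter
  mult := H.mult
  acc w hw s e' c h1 h2 h3 h4 := by
    rw [← e w hw]; exact H.acc w hw s e' c h1 h2 h3 h4

/-! ### Projection -/

def pM (n m : ℕ) : ℕ := Nat.pair n (Nat.pair m n)

def pMul (n m : ℕ) (mul : ℕ → ℕ → ℕ) (A E : ℕ) : ℕ :=
  mk (pM n m) fun i => decide (i.unpair.1 < n) && (decide (i.unpair.2.unpair.2 < n) &&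
    bex m fun s1 => bex m fun s2 => bex n fun r =>
    bit A (Nat.pair i.unpair.1 (Nat.pair s1 r)) &&
    (bit E (Nat.pair r (Nat.pair s2 i.unpair.2.unpair.2)) &&
    decide (mul s1 s2 = i.unpair.2.unpair.1)))

def pH (n m : ℕ) (h : ℕ → ℕ) (tr : ℕ → ℕ → ℕ → Bool) (l : ℕ) : ℕ :=
  mk (pM n m) fun i =>
    decide (i.unpair.1 < n) && (decide (i.unpair.2.unpair.2 < n) &&
    (tr l i.unpair.1 i.unpair.2.unpair.2 &&
    decide (h (Nat.pair i.unpair.1 l) = i.unpair.2.unpair.1)))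

def pP (n m : ℕ) (mul : ℕ → ℕ → ℕ) (P : ℕ → ℕ → Bool) (ini : ℕ → Bool) (A E : ℕ) : Bool :=
  bex m fun s => bex m fun e => bex n fun q => bex n fun p =>
    ini p && (bit A (Nat.pair p (Nat.pair s q)) && (bit E (Nat.pair q (Nat.pair e q)) &&
    (P s e && (decide (mul s e = s) && decide (mul e e = e)))))

def Seg (n : ℕ) (tr : ℕ → ℕ → ℕ → Bool) (V : (ℕ → ℕ) → ℕ → ℕ → ℕ) (w : ℕ → ℕ)
    (i j p s q : ℕ) : Prop :=
  ∃ r : ℕ → ℕ, (∀ t, r t < n) ∧ r i = p ∧ r j = q ∧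
    (∀ t, i ≤ t → t < j → tr (w t) (r t) (r (t + 1)) = true) ∧
    V (fun t => Nat.pair (r t) (w t)) i j = s

open Classical in
noncomputable def pV (n m : ℕ) (tr : ℕ → ℕ → ℕ → Bool) (V : (ℕ → ℕ) → ℕ → ℕ → ℕ)
    (w : ℕ → ℕ) (i j : ℕ) : ℕ :=
  mk (pM n m) fun k => decide (Seg n tr V w i j k.unpair.1 k.unpair.2.unpair.1 k.unpair.2.unpair.2)

theorem bit_pV {n m : ℕ} {tr V w i j p s q} (hp : p < n) (hs : s < m) (hq : q < n) :
    bit (pV n m tr V w i j) (Nat.pair p (Nat.pair s q)) = true ↔ Seg n tr V w i j p s q := by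
  rw [pV, bit_mk (show _ < pM n m from pair_lt hp (pair_lt hs hq))]
  simp

theorem exists_block (b : ℕ → ℕ) (hb : StrictMono b) (h0 : b 0 = 0) :
    ∃ k : ℕ → ℕ, ∀ t, b (k t) ≤ t ∧ t < b (k t + 1) := by
  have : ∀ t, ∃ k, b k ≤ t ∧ t < b (k + 1) := by
    intro t
    induction t with
    | zero => exact ⟨0, by omega, by have := hb (show 0 < 0 + 1 by omega); omega⟩
    | succ t ih =>
      obtain ⟨k, h1, h2⟩ := ih
      by_cases h : t + 1 < b (k + 1)
      · exact ⟨k, by omega, h⟩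
      · have := hb (show k + 1 < k + 1 + 1 by omega)
        exact ⟨k + 1, by omega, by omega⟩
  choose k hk using this
  exact ⟨k, hk⟩

/-- Gluing of segments along a sequence of cuts. -/
theorem glue {n : ℕ} {R : ℕ → ℕ → ℕ → Prop} (b : ℕ → ℕ) (hb : StrictMono b) (h0 : b 0 = 0)
    (r : ℕ → ℕ → ℕ) (hr : ∀ k t, r k t < n)
    (hR : ∀ k t, b k ≤ t → t < b (k + 1) → R t (r k t) (r k (t + 1)))
    (hm : ∀ k, r k (b (k + 1)) = r (k + 1) (b (k + 1))) :
    ∃ p : ℕ → ℕ, (∀ t, p t < n) ∧ (∀ t, R t (p t) (p (t + 1))) ∧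
      (∀ k t, b k ≤ t → t ≤ b (k + 1) → p t = r k t) := by
  obtain ⟨κ, hκ⟩ := exists_block b hb h0
  have huniq : ∀ k t, b k ≤ t → t < b (k + 1) → κ t = k := by
    intro k t h1 h2
    obtain ⟨h3, h4⟩ := hκ t
    rcases lt_trichotomy (κ t) k with h | h | h
    · have := hb.monotone (show κ t + 1 ≤ k from h); omega
    · exact h
    · have := hb.monotone (show k + 1 ≤ κ t from h); omega
  have key : ∀ k t, b k ≤ t → t ≤ b (k + 1) → r (κ t) t = r k t := by
    intro k t h1 h2
    rcases h2.lt_or_eq with h | rfl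
    · rw [huniq k t h1 h]
    · rw [huniq (k + 1) _ le_rfl (hb (by omega)), hm]
  refine ⟨fun t => r (κ t) t, fun t => hr _ _, fun t => ?_, key⟩
  have := hR (κ t) t (hκ t).1 (hκ t).2
  rw [← key (κ t) (t + 1) (by have := (hκ t).1; omega) (hκ t).2] at this
  exact this

theorem Recog.proj {B' n : ℕ} {tr : ℕ → ℕ → ℕ → Bool} {ini : ℕ → Bool}
    (H : Recog B m mul h P L V) (hB : ∀ p < n, ∀ l < B', Nat.pair p l < B) :
    Recog B' (2 ^ pM n m) (pMul n m mul) (pH n m h tr) (pP n m mul P ini)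
      (fun w => ∃ p : ℕ → ℕ, (∀ t, p t < n) ∧ ini (p 0) = true ∧
        (∀ t, tr (w t) (p t) (p (t + 1)) = true) ∧ L (fun t => Nat.pair (p t) (w t)))
      (pV n m tr V) where
  lt w hw i j hij := mk_lt _ _
  letter w hw i := by
    refine mk_congr' fun k hk => ?_
    simp only [decide_eq_true_eq, Bool.and_eq_true]
    constructor
    · rintro ⟨r, h1, h2, h3, h4, h5⟩
      rw [H.letter _ (fun t => hB _ (h1 t) _ (hw t))] at h5
      rw [← h2, ← h3, ← h5]
      exact ⟨h1 _, h1 _, h4 i le_rfl (by omega), rfl⟩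
    · rintro ⟨h1, h2, h3, h4⟩
      refine ⟨fun t => if t ≤ i then k.unpair.1 else k.unpair.2.unpair.2, ?_, by simp, by simp,
        ?_, ?_⟩
      · intro t; dsimp only; split_ifs <;> assumption
      · intro t ht1 ht2
        obtain rfl : t = i := by omega
        simpa using h3
      · rw [H.letter]
        · simpa using h4
        · intro t
          refine hB _ ?_ _ (hw t)
          dsimp only; split_ifs <;> assumption
  mult w hw i j k hij hjk := by
    refine mk_congr' fun z hz => ?_
    generalize z.unpair.1 = p
    generalize z.unpair.2.unpair.1 = s
    generalize z.unpair.2.unpair.2 = q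
    simp only [decide_eq_true_eq, Bool.and_eq_true, bex_iff]
    constructor
    · rintro ⟨r, h1, h2, h3, h4, h5⟩
      have hb : ∀ t, Nat.pair (r t) (w t) < B := fun t => hB _ (h1 t) _ (hw t)
      refine ⟨h2 ▸ h1 i, h3 ▸ h1 k, _, H.lt _ hb i j hij, _, H.lt _ hb j k hjk, r j, h1 j, ?_, ?_, ?_⟩
      · rw [bit_pV (h2 ▸ h1 i) (H.lt _ hb i j hij) (h1 j)]
        exact ⟨r, h1, h2, rfl, fun t ht1 ht2 => h4 t ht1 (by omega), rfl⟩
      · rw [bit_pV (h1 j) (H.lt _ hb j k hjk) (h3 ▸ h1 k)]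
        exact ⟨r, h1, rfl, h3, fun t ht1 ht2 => h4 t (by omega) ht2, rfl⟩
      · rw [← h5, H.mult _ hb i j k hij hjk]
    · rintro ⟨hp, hq, s1, hs1, s2, hs2, x, hx, hA, hE, hm⟩
      rw [bit_pV hp hs1 hx] at hA
      rw [bit_pV hx hs2 hq] at hE
      obtain ⟨r, h1, h2, h3, h4, h5⟩ := hA
      obtain ⟨r', h1', h2', h3', h4', h5'⟩ := hE
      have hlt : ∀ t, (if t ≤ j then r t else r' t) < n := fun t => by
        split_ifs
        · exact h1 t
        · exact h1' t
      have hr' : ∀ t, j ≤ t → (if t ≤ j then r t else r' t) = r' t := fun t ht => by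
        split_ifs with hh
        · obtain rfl : t = j := by omega
          rw [h3, h2']
        · rfl
      refine ⟨fun t => if t ≤ j then r t else r' t, hlt, ?_, ?_, ?_, ?_⟩
      · simp [hij.le, h2]
      · exact (hr' k hjk.le).trans h3'
      · intro t ht1 ht2
        by_cases htj : t < j
        · have := h4 t ht1 htj
          simpa [htj.le, show t + 1 ≤ j from htj] using this
        · have := h4' t (by omega) ht2
          simp only [hr' t (by omega), hr' (t + 1) (by omega)]
          exact this
      · have hb : ∀ t, Nat.pair (if t ≤ j then r t else r' t) (w t) < B :=
          fun t => hB _ (hlt t) _ (hw t)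
        rw [H.mult _ hb i j k hij hjk, ← hm, ← h5, ← h5']
        congr 1
        · refine H.loc hb (fun t => hB _ (h1 t) _ (hw t)) hij fun t _ ht => ?_
          simp [ht.le]
        · refine H.loc hb (fun t => hB _ (h1' t) _ (hw t)) hjk fun t ht _ => ?_
          simp only [hr' t ht]
  acc w hw A E c hc h0 hA hE := by
    simp only [pP, decide_eq_true_eq, Bool.and_eq_true, bex_iff]
    constructor
    · rintro ⟨p, h1, h2, h3, h4⟩
      have hb : ∀ t, Nat.pair (p t) (w t) < B := fun t => hB _ (h1 t) _ (hw t)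
      obtain ⟨g, s, e, q, hg, hs, he, hq⟩ := H.fact hb p h1 c hc h0
      have hcp : ∀ i, 0 < c i := fun i => lt_of_lt_of_le h0 (hc.monotone (Nat.zero_le _))
      have hsm : s < m := hs 0 ▸ H.lt _ hb _ _ (hcp _)
      have hem : e < m := he 0 1 (by omega) ▸ H.lt _ hb _ _ (hc (hg (by omega)))
      have hqn : q < n := hq 0 ▸ h1 _
      refine ⟨s, hsm, e, hem, q, hqn, p 0, h1 0, h2, ?_, ?_, ?_, ?_, ?_⟩
      · rw [← hA (g 0), bit_pV (h1 0) hsm hqn]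
        exact ⟨p, h1, rfl, hq 0, fun t _ _ => h3 t, hs 0⟩
      · rw [← hE (g 0) (g 1) (hg (by omega)), bit_pV hqn hem hqn]
        exact ⟨p, h1, hq 0, hq 1, fun t _ _ => h3 t, he 0 1 (by omega)⟩
      · exact (H.acc _ hb s e _ (hc.comp hg) (hcp _) hs he).1 h4
      · have := H.mult _ hb 0 (c (g 0)) (c (g 1)) (hcp _) (hc (hg (by omega)))
        rw [hs, hs, he 0 1 (by omega)] at this
        exact this.symm
      · have := H.mult _ hb (c (g 0)) (c (g 1)) (c (g 2)) (hc (hg (by omega))) (hc (hg (by omega)))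
        rw [he 0 1 (by omega), he 1 2 (by omega), he 0 2 (by omega)] at this
        exact this.symm
    · rintro ⟨s, hs, e, he, q, hq, x, hx, hini, hAx, hEx, hP, hse, hee⟩
      have hA' : Seg n tr V w 0 (c 0) x s q := by
        rw [← bit_pV hx hs hq, hA 0]; exact hAx
      have hE' : ∀ i, Seg n tr V w (c i) (c (i + 1)) q e q := fun i => by
        rw [← bit_pV hq he hq, hE i (i + 1) (by omega)]; exact hEx
      obtain ⟨r0, a1, a2, a3, a4, a5⟩ := hA'
      choose r1 b1 b2 b3 b4 b5 using hE'
      let b : ℕ → ℕ := fun k => Nat.casesOn k 0 c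
      let r : ℕ → ℕ → ℕ := fun k => Nat.casesOn k r0 r1
      have hbm : StrictMono b := strictMono_nat_of_lt_succ fun k => by
        cases k with
        | zero => exact h0
        | succ k => exact hc (Nat.lt_succ_self k)
      obtain ⟨p, p1, p2, p3⟩ := glue (n := n) (R := fun t x y => tr (w t) x y = true) b hbm rfl r
        (fun k => by cases k with
          | zero => exact a1
          | succ k => exact b1 k)
        (fun k => by cases k with
          | zero => exact a4
          | succ k => exact b4 k)
        (fun k => by cases k with
          | zero => exact a3.trans (b2 0).symm
          | succ k => exact (b3 k).trans (b2 (k + 1)).symm)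
      have hb : ∀ t, Nat.pair (p t) (w t) < B := fun t => hB _ (p1 t) _ (hw t)
      have v0 : V (fun t => Nat.pair (p t) (w t)) 0 (c 0) = s := by
        rw [← a5]
        refine H.loc hb (fun t => hB _ (a1 t) _ (hw t)) h0 fun t h1 h2 => ?_
        rw [p3 0 t h1 h2.le]; rfl
      have v1 : ∀ i, V (fun t => Nat.pair (p t) (w t)) (c i) (c (i + 1)) = e := fun i => by
        rw [← b5 i]
        refine H.loc hb (fun t => hB _ (b1 i t) _ (hw t)) (hc (by omega)) fun t h1 h2 => ?_
        rw [p3 (i + 1) t h1 h2.le]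
      have v2 : ∀ i j, i < j → V (fun t => Nat.pair (p t) (w t)) (c i) (c j) = e := by
        intro i j hij
        induction j with
        | zero => omega
        | succ j ih =>
          rcases Nat.lt_succ_iff_lt_or_eq.1 hij with h1 | rfl
          · rw [H.mult _ hb _ (c j) _ (hc h1) (hc (by omega)), ih h1, v1, hee]
          · exact v1 i
      refine ⟨p, p1, ?_, p2, ?_⟩
      · rw [p3 0 0 le_rfl (Nat.zero_le _)]
        show ini (r0 0) = true
        rw [a2]; exact hini
      · refine (H.acc _ hb s e c hc h0 (fun i => ?_) v2).2 hP
        cases i with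
        | zero => exact v0
        | succ i =>
          rw [H.mult _ hb 0 (c 0) _ h0 (hc (by omega)), v0, v2 0 (i + 1) (by omega), hse]


/-! ### Tables as data -/

abbrev Dat : Type := ℕ × List ℕ × List ℕ × List Bool

def dm (D : Dat) : ℕ := D.1

def dmul (D : Dat) (a b : ℕ) : ℕ := D.2.1.getD (Nat.pair a b) 0

def dh (D : Dat) (l : ℕ) : ℕ := D.2.2.1.getD l 0

def dP (D : Dat) (a b : ℕ) : Bool := D.2.2.2.getD (Nat.pair a b) false

def mkDat (B m : ℕ) (mul : ℕ → ℕ → ℕ) (h : ℕ → ℕ) (P : ℕ → ℕ → Bool) : Dat :=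
  (m, tab (Nat.pair m m) (fun i => mul i.unpair.1 i.unpair.2), tab B h,
    tab (Nat.pair m m) (fun i => P i.unpair.1 i.unpair.2))

def RecogD (B : ℕ) (D : Dat) (L : (ℕ → ℕ) → Prop) : Prop :=
  ∃ V, Recog B (dm D) (dmul D) (dh D) (dP D) L V

theorem RecogD.congr {D : Dat} (H : RecogD B D L) {L' : (ℕ → ℕ) → Prop}
    (e : ∀ w, (∀ t, w t < B) → (L w ↔ L' w)) : RecogD B D L' := by
  obtain ⟨V, hV⟩ := H
  exact ⟨V, hV.congr e⟩

theorem Recog.mkDat (H : Recog B m mul h P L V) : RecogD B (mkDat B m mul h P) L := by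
  have e1 : ∀ a b, a < m → b < m → dmul (HMC.mkDat B m mul h P) a b = mul a b := by
    intro a b ha hb
    show (tab _ _).getD _ _ = _
    rw [getD_tab _ (pair_lt ha hb)]
    simp
  have e2 : ∀ a b, a < m → b < m → dP (HMC.mkDat B m mul h P) a b = P a b := by
    intro a b ha hb
    show (tab _ _).getD _ _ = _
    rw [getD_tab _ (pair_lt ha hb)]
    simp
  refine ⟨V, H.lt, fun w hw i => ?_, fun w hw i j k hij hjk => ?_, ?_⟩
  · rw [H.letter w hw]
    show _ = (tab _ _).getD _ _
    rw [getD_tab _ (hw i)]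
  · rw [e1 _ _ (H.lt w hw _ _ hij) (H.lt w hw _ _ hjk)]
    exact H.mult w hw i j k hij hjk
  · intro w hw s e c hc h0 hs he
    rw [e2 s e (hs 0 ▸ H.lt w hw _ _ h0) (he 0 1 (by omega) ▸ H.lt w hw _ _ (hc (by omega)))]
    exact H.acc w hw s e c hc h0 hs he

/-! ### One quantifier step -/

def flip (b x : Bool) : Bool := cond b x (!x)

def qstep (b : Bool) (n B : ℕ) (ini : ℕ → Bool) (tr : ℕ → ℕ → ℕ → Bool) (D : Dat) : Dat :=
  mkDat B (2 ^ pM n (dm D)) (pMul n (dm D) (dmul D)) (pH n (dm D) (dh D) tr)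
    (fun A E => flip b (pP n (dm D) (dmul D) (fun s e => flip b (dP D s e)) ini A E))

theorem qstep_ex {B' n : ℕ} {tr : ℕ → ℕ → ℕ → Bool} {ini : ℕ → Bool} {D : Dat}
    (H : RecogD B D L) (hB : ∀ p < n, ∀ l < B', Nat.pair p l < B) :
    RecogD B' (qstep true n B' ini tr D)
      (fun w => ∃ p : ℕ → ℕ, (∀ t, p t < n) ∧ ini (p 0) = true ∧
        (∀ t, tr (w t) (p t) (p (t + 1)) = true) ∧ L (fun t => Nat.pair (p t) (w t))) := by
  obtain ⟨V, hV⟩ := H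
  exact (hV.proj (ini := ini) (tr := tr) hB).mkDat

theorem qstep_all {B' n : ℕ} {tr : ℕ → ℕ → ℕ → Bool} {ini : ℕ → Bool} {D : Dat}
    (H : RecogD B D L) (hB : ∀ p < n, ∀ l < B', Nat.pair p l < B) :
    RecogD B' (qstep false n B' ini tr D)
      (fun w => ∀ p : ℕ → ℕ, (∀ t, p t < n) → ini (p 0) = true →
        (∀ t, tr (w t) (p t) (p (t + 1)) = true) → L (fun t => Nat.pair (p t) (w t))) := by
  obtain ⟨V, hV⟩ := H
  refine RecogD.congr (hV.compl.proj (ini := ini) (tr := tr) hB).compl.mkDat ?_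
  intro w hw
  push Not
  rfl

/-! ### The fairness language -/

def fair (i x : ℕ) : Bool :=
  !(decide (4 ≤ i.unpair.1)) || (!(bit x i) || bit x i.unpair.2.unpair.2)

def fairDat (B c : ℕ) : Dat :=
  mkDat B (2 ^ c) (fun a b => mk c fun i => bit a i || bit b i)
    (fun l => mk c fun i => fair i l.unpair.1) (fun _ e => ball c fun i => bit e i)

theorem fairDat_recog (B c : ℕ) :
    RecogD B (fairDat B c) (fun w => ∀ i < c, ∀ N, ∃ t ≥ N, fair i (w t).unpair.1 = true) := by
  classical
  refine Recog.mkDat (V := fun w i j => mk c fun k =>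
    decide (∃ t, i ≤ t ∧ t < j ∧ fair k (w t).unpair.1 = true)) ⟨?_, ?_, ?_, ?_⟩
  · intro w hw i j hij
    exact mk_lt _ _
  · intro w hw i
    refine mk_congr' fun k hk => ?_
    rw [decide_eq_true_eq]
    constructor
    · rintro ⟨t, h1, h2, h3⟩
      obtain rfl : t = i := by omega
      exact h3
    · intro h
      exact ⟨i, le_rfl, by omega, h⟩
  · intro w hw i j k hij hjk
    refine mk_congr' fun z hz => ?_
    rw [bit_mk hz, bit_mk hz]
    simp only [decide_eq_true_eq, Bool.or_eq_true]
    constructor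
    · rintro ⟨t, h1, h2, h3⟩
      by_cases h : t < j
      · exact Or.inl ⟨t, h1, h, h3⟩
      · exact Or.inr ⟨t, by omega, h2, h3⟩
    · rintro (⟨t, h1, h2, h3⟩ | ⟨t, h1, h2, h3⟩)
      · exact ⟨t, h1, by omega, h3⟩
      · exact ⟨t, by omega, h2, h3⟩
  · intro w hw s e c' hc h0 hs he
    rw [ball_iff]
    refine forall₂_congr fun k hk => ?_
    constructor
    · intro h
      obtain ⟨t, ht, hf⟩ := h (c' 0)
      have h2 : t < c' (t + 1) := lt_of_lt_of_le (Nat.lt_succ_self t) hc.le_apply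
      rw [← he 0 (t + 1) (by omega), bit_mk hk, decide_eq_true_eq]
      exact ⟨t, ht, h2, hf⟩
    · intro h N
      rw [← he N (N + 1) (by omega), bit_mk hk, decide_eq_true_eq] at h
      obtain ⟨t, h1, h2, h3⟩ := h
      exact ⟨t, le_trans hc.le_apply h1, h3⟩

/-! ### The tableau -/

/-- Local consistency of the valuations `x`, `y` at two successive positions, at code `i`. -/
def loc (atm : ℕ → ℕ → Bool) (i x y : ℕ) : Bool :=
  bit x i ==
    cond (decide (i.unpair.1 = 0)) (atm i.unpair.2.unpair.1 i.unpair.2.unpair.2)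
    (cond (decide (i.unpair.1 = 1)) (!(bit x i.unpair.2))
    (cond (decide (i.unpair.1 = 2)) (bit x i.unpair.2.unpair.1 && bit x i.unpair.2.unpair.2)
    (cond (decide (i.unpair.1 = 3)) (bit y i.unpair.2)
      (bit x i.unpair.2.unpair.2 || (bit x i.unpair.2.unpair.1 && bit y i)))))

theorem sub_lt {i : ℕ} (h : i.unpair.1 ≠ 0) : i.unpair.2 < i := by
  have := Nat.unpair_add_le i
  omega

theorem sub1_lt {i : ℕ} (h : i.unpair.1 ≠ 0) : i.unpair.2.unpair.1 < i :=
  lt_of_le_of_lt (Nat.unpair_left_le _) (sub_lt h)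

theorem sub2_lt {i : ℕ} (h : i.unpair.1 ≠ 0) : i.unpair.2.unpair.2 < i :=
  lt_of_le_of_lt (Nat.unpair_right_le _) (sub_lt h)

/-- Every number codes a formula. -/
def dec (i : ℕ) : QF :=
  if h0 : i.unpair.1 = 0 then .atom i.unpair.2.unpair.1 i.unpair.2.unpair.2
  else if i.unpair.1 = 1 then .not (dec i.unpair.2)
  else if i.unpair.1 = 2 then .and (dec i.unpair.2.unpair.1) (dec i.unpair.2.unpair.2)
  else if i.unpair.1 = 3 then .next (dec i.unpair.2)
  else .xuntil (dec i.unpair.2.unpair.1) (dec i.unpair.2.unpair.2)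
termination_by i
decreasing_by
  all_goals first
    | exact sub_lt h0
    | exact sub1_lt h0
    | exact sub2_lt h0

theorem dec_enc (ψ : QF) : dec ψ.enc = ψ := by
  induction ψ with
  | atom a p => rw [dec]; simp [QF.enc]
  | not ψ ih => rw [dec]; simp [QF.enc, ih]
  | and a b iha ihb => rw [dec]; simp [QF.enc, iha, ihb]
  | next ψ ih => rw [dec]; simp [QF.enc, ih]
  | xuntil a b iha ihb => rw [dec]; simp [QF.enc, iha, ihb]

theorem until_iff (Pi : ℕ → Trace) (t : ℕ) (a b : QF) :
    QF.Sat Pi t (.xuntil a b) ↔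
      (QF.Sat Pi t b ∨ (QF.Sat Pi t a ∧ QF.Sat Pi (t + 1) (.xuntil a b))) := by
  simp only [QF.Sat]
  constructor
  · rintro ⟨k, h1, h2, h3⟩
    rcases h1.lt_or_eq with h | rfl
    · exact Or.inr ⟨h3 t le_rfl h, k, h, h2, fun j hj hjk => h3 j (by omega) hjk⟩
    · exact Or.inl h2
  · rintro (h | ⟨h, k, h1, h2, h3⟩)
    · exact ⟨t, le_rfl, h, fun j _ _ => by omega⟩
    · refine ⟨k, by omega, h2, fun j hj hjk => ?_⟩
      rcases hj.lt_or_eq with h4 | rfl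
      · exact h3 j h4 hjk
      · exact h

theorem tableau (Pi : ℕ → Trace) (atm : ℕ → ℕ → ℕ → Bool)
    (hatm : ∀ t a v, a ∈ Pi v t ↔ atm t a v = true) (ψ : ℕ) :
    (∃ x : ℕ → ℕ, (∀ t, x t < 2 ^ (ψ + 1)) ∧ bit (x 0) ψ = true ∧
      (∀ t, ball (ψ + 1) (fun i => loc (atm t) i (x t) (x (t + 1))) = true) ∧
      (∀ i < ψ + 1, ∀ N, ∃ t ≥ N, fair i (x t) = true)) ↔ QF.Sat Pi 0 (dec ψ) := by
  classical
  constructor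
  · rintro ⟨x, -, h2, h3, h4⟩
    have key : ∀ i, i < ψ + 1 → ∀ t, bit (x t) i = true ↔ QF.Sat Pi t (dec i) := by
      intro i
      induction i using Nat.strong_induction_on with
      | _ i ih =>
        intro hi t
        have hl : ∀ t, loc (atm t) i (x t) (x (t + 1)) = true := fun t => ball_iff.1 (h3 t) i hi
        simp only [loc, beq_iff_eq] at hl
        rw [dec]
        by_cases c0 : i.unpair.1 = 0
        · rw [hl t]; simp [c0, QF.Sat, hatm]
        have ih0 := ih _ (sub_lt c0) ((sub_lt c0).trans hi)
        have ih1 := ih _ (sub1_lt c0) ((sub1_lt c0).trans hi)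
        have ih2 := ih _ (sub2_lt c0) ((sub2_lt c0).trans hi)
        by_cases c1 : i.unpair.1 = 1
        · rw [hl t]; simp [c1, QF.Sat, ← ih0]
        by_cases c2 : i.unpair.1 = 2
        · rw [hl t]; simp [c2, QF.Sat, ← ih1, ← ih2]
        by_cases c3 : i.unpair.1 = 3
        · rw [hl t]; simp [c3, QF.Sat, ← ih0]
        have c4 : 4 ≤ i.unpair.1 := by omega
        simp only [c0, c1, c2, c3, decide_false, cond_false] at hl
        simp only [c0, c1, c2, c3, if_false, dite_false]
        have hl' : ∀ t, bit (x t) i = true ↔ (QF.Sat Pi t (dec i.unpair.2.unpair.2) ∨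
            (QF.Sat Pi t (dec i.unpair.2.unpair.1) ∧ bit (x (t + 1)) i = true)) := by
          intro t
          rw [hl t, Bool.or_eq_true, Bool.and_eq_true, ih1, ih2]
        constructor
        · intro hb
          obtain ⟨t', ht', hf⟩ := h4 i hi t
          obtain ⟨d, rfl⟩ : ∃ d, t' = t + d := ⟨t' - t, by omega⟩
          clear ht'
          induction d generalizing t with
          | zero =>
            rw [until_iff]
            left
            simp only [fair, c4, hb, add_zero, decide_true, Bool.not_true, Bool.false_or] at hf
            exact (ih2 t).1 hf
          | succ d ihd =>
            rw [until_iff]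
            rcases (hl' t).1 hb with h | ⟨h, h'⟩
            · exact Or.inl h
            · refine Or.inr ⟨h, ihd (t + 1) h' ?_⟩
              rw [show t + 1 + d = t + (d + 1) by omega]; exact hf
        · rintro ⟨k, h1, h5, h6⟩
          obtain ⟨d, rfl⟩ : ∃ d, k = t + d := ⟨k - t, by omega⟩
          clear h1
          induction d generalizing t with
          | zero => exact (hl' t).2 (Or.inl h5)
          | succ d ihd =>
            refine (hl' t).2 (Or.inr ⟨h6 t le_rfl (by omega), ihd (t + 1) ?_ ?_⟩)
            · rw [show t + 1 + d = t + (d + 1) by omega]; exact h5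
            · intro j h1 h2
              exact h6 j (by omega) (by omega)
    exact (key ψ (by omega) 0).1 h2
  · intro hs
    have hb : ∀ i, i < ψ + 1 → ∀ t,
        bit (mk (ψ + 1) fun i => decide (QF.Sat Pi t (dec i))) i =
          decide (QF.Sat Pi t (dec i)) := fun i hi t => bit_mk hi
    refine ⟨fun t => mk (ψ + 1) fun i => decide (QF.Sat Pi t (dec i)), fun t => mk_lt _ _,
      ?_, fun t => ?_, fun i hi N => ?_⟩
    · simp only [hb ψ (by omega)]
      simpa using hs
    · rw [ball_iff]
      intro i hi
      simp only [loc, beq_iff_eq, hb i hi]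
      rw [Bool.eq_iff_iff, decide_eq_true_eq]
      by_cases c0 : i.unpair.1 = 0
      · rw [dec]
        simp [c0, QF.Sat, hatm]
      have b0 := hb _ ((sub_lt c0).trans hi)
      have b1 := hb _ ((sub1_lt c0).trans hi)
      have b2 := hb _ ((sub2_lt c0).trans hi)
      simp only [b0, b1, b2]
      by_cases c1 : i.unpair.1 = 1
      · rw [dec]; simp [c1, QF.Sat]
      by_cases c2 : i.unpair.1 = 2
      · rw [dec]; simp [c2, QF.Sat]
      by_cases c3 : i.unpair.1 = 3
      · rw [dec]; simp [c3, QF.Sat]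
      have e : dec i = .xuntil (dec i.unpair.2.unpair.1) (dec i.unpair.2.unpair.2) := by
        rw [dec]; simp [c0, c1, c2, c3]
      simp only [c0, c1, c2, c3, decide_false, cond_false, Bool.or_eq_true, Bool.and_eq_true,
        decide_eq_true_eq]
      rw [e]
      exact until_iff _ _ _ _
    · by_cases c4 : 4 ≤ i.unpair.1
      swap
      · exact ⟨N, le_rfl, by simp [fair, c4]⟩
      have c0 : i.unpair.1 ≠ 0 := by omega
      have b2 := hb _ ((sub2_lt c0).trans hi)
      have e : dec i = .xuntil (dec i.unpair.2.unpair.1) (dec i.unpair.2.unpair.2) := by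
        rw [dec]
        simp [c0, show i.unpair.1 ≠ 1 by omega, show i.unpair.1 ≠ 2 by omega,
          show i.unpair.1 ≠ 3 by omega]
      by_cases hN : QF.Sat Pi N (dec i)
      · rw [e] at hN
        obtain ⟨k, h1, h2, -⟩ := hN
        refine ⟨k, h1, ?_⟩
        simp [fair, b2, h2]
      · refine ⟨N, le_rfl, ?_⟩
        simp [fair, hb i hi, hN]

/-! ### The final answer for the unique word over a one-letter alphabet -/

def fin (D : Dat) : Bool :=
  bex (dm D) fun e => decide (dmul D e e = e) && (dP D e e &&
    ball (2 ^ dm D) fun X =>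
      !(bit X (dh D 0) && ball (dm D) (fun x => !(bit X x) || bit X (dmul D x (dh D 0)))) ||
        bit X e)

theorem fin_iff {D : Dat} (H : RecogD 1 D L) : fin D = true ↔ L (fun _ => 0) := by
  classical
  obtain ⟨V, H⟩ := H
  have hw : ∀ t : ℕ, (fun _ => 0 : ℕ → ℕ) t < 1 := fun t => by simp
  have hstep : ∀ i, V (fun _ => 0) 0 (i + 2) = dmul D (V (fun _ => 0) 0 (i + 1)) (dh D 0) := by
    intro i
    rw [H.mult _ hw 0 (i + 1) (i + 2) (by omega) (by omega), H.letter _ hw]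
  have hsh : ∀ i d, V (fun _ => 0) i (i + (d + 1)) = V (fun _ => 0) 0 (d + 1) := by
    intro i d
    induction d with
    | zero =>
      have h1 := H.letter _ hw i
      have h2 := H.letter _ hw 0
      simp only [zero_add] at h2 ⊢
      rw [h1, h2]
    | succ d ih =>
      rw [H.mult _ hw i (i + (d + 1)) _ (by omega) (by omega), ih, hstep]
      congr 1
      exact H.letter _ hw _
  have hpow : ∀ k e, 0 < k → V (fun _ => 0) 0 k = e → dmul D e e = e →
      (L (fun _ => 0) ↔ dP D e e = true) := by
    intro k e hk he hee
    have h1 : ∀ d, V (fun _ => 0) 0 ((d + 1) * k) = e := by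
      intro d
      induction d with
      | zero => simpa using he
      | succ d ih =>
        have hpos : 0 < (d + 1) * k := by positivity
        rw [H.mult _ hw 0 ((d + 1) * k) _ hpos (by nlinarith), ih]
        have h2 := hsh ((d + 1) * k) (k - 1)
        rw [show k - 1 + 1 = k by omega, he] at h2
        rw [show (d + 1 + 1) * k = (d + 1) * k + k by ring, h2, hee]
    refine H.acc _ hw e e (fun i => (i + 1) * k) ?_ (by simpa using hk) h1 ?_
    · intro i j hij
      exact Nat.mul_lt_mul_of_pos_right (by omega) hk
    · intro i j hij
      obtain ⟨d, rfl⟩ : ∃ d, j = i + (d + 1) := ⟨j - i - 1, by omega⟩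
      have hpos : 0 < (d + 1) * k := by positivity
      have h2 := hsh ((i + 1) * k) ((d + 1) * k - 1)
      rw [show (d + 1) * k - 1 + 1 = (d + 1) * k by omega, h1] at h2
      rw [← h2]
      congr 1
      ring
  simp only [fin, bex_iff, Bool.and_eq_true, decide_eq_true_eq, ball_iff]
  constructor
  · rintro ⟨e, he, hee, hP, hX⟩
    have h1 := hX (mk (dm D) fun x => decide (∃ k, x = V (fun _ => 0) 0 (k + 1))) (mk_lt _ _)
    rw [Bool.or_eq_true, bit_mk he, decide_eq_true_eq] at h1
    rcases h1 with h1 | ⟨k, hk⟩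
    · exfalso
      rw [Bool.not_eq_true', ← Bool.not_eq_true] at h1
      apply h1
      have hh : dh D 0 = V (fun _ => 0) 0 (0 + 1) := (H.letter _ hw 0).symm
      have hlt : dh D 0 < dm D := hh ▸ H.lt _ hw _ _ (by omega)
      rw [Bool.and_eq_true, bit_mk hlt, decide_eq_true_eq, ball_iff]
      refine ⟨⟨0, hh⟩, fun x hx => ?_⟩
      rw [bit_mk hx, Bool.or_eq_true, Bool.not_eq_true', decide_eq_false_iff_not]
      by_cases hk : ∃ k, x = V (fun _ => 0) 0 (k + 1)
      · right
        obtain ⟨k, rfl⟩ := hk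
        rw [← hstep, bit_mk (H.lt _ hw _ _ (by omega)), decide_eq_true_eq]
        exact ⟨k + 1, rfl⟩
      · exact Or.inl hk
    · exact (hpow (k + 1) e (by omega) hk.symm hee).2 hP
  · intro hL
    obtain ⟨g, s, e, q, hg, hs, he, -⟩ := H.fact hw (n := 1) (fun _ => 0) (by simp)
      (fun i => i + 1) (fun i j hij => by simpa using hij) (by simp)
    have g01 := hg (show 0 < 1 by omega)
    have g12 := hg (show 1 < 2 by omega)
    have hee : dmul D e e = e := by
      have := H.mult _ hw (g 0 + 1) (g 1 + 1) (g 2 + 1) (by omega) (by omega)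
      rw [he 0 1 (by omega), he 1 2 (by omega), he 0 2 (by omega)] at this
      exact this.symm
    obtain ⟨d, hd⟩ : ∃ d, g 1 + 1 = g 0 + 1 + (d + 1) := ⟨g 1 - g 0 - 1, by omega⟩
    have hed : V (fun _ => 0) 0 (d + 1) = e := by
      rw [← hsh (g 0 + 1) d, ← hd]; exact he 0 1 (by omega)
    refine ⟨e, hed ▸ H.lt _ hw _ _ (by omega), hee, (hpow _ e (by omega) hed hee).1 hL, ?_⟩
    intro X _
    rw [Bool.or_eq_true, Bool.not_eq_true']
    by_cases hX : (bit X (dh D 0) &&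
      ball (dm D) fun x => !(bit X x) || bit X (dmul D x (dh D 0))) = true
    · right
      rw [Bool.and_eq_true, ball_iff] at hX
      rw [← hed]
      clear hed hd
      induction d with
      | zero => rw [H.letter _ hw 0]; exact hX.1
      | succ d ih =>
        have h2 := hX.2 _ (H.lt _ hw 0 (d + 1) (by omega))
        rw [ih, ← hstep] at h2
        simpa using h2
    · left
      simpa using hX


/-! ### The whole algorithm -/

def memb (l : List ℕ) (a : ℕ) : Bool := decide (l.idxOf a < l.length)

theorem memb_iff {l : List ℕ} {a : ℕ} : memb l a = true ↔ a ∈ l := by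
  simp [memb, List.idxOf_lt_length_iff]

def lk (ll : List (List ℕ)) (s a : ℕ) : Bool := memb (ll.getD s []) a

/-- Does the trace assigned to `v` carry the proposition `a`, if the current letter is `l`? -/
def atm (ll : List (List ℕ)) (ctx : List ℕ) (l a v : ℕ) : Bool :=
  decide (ctx.idxOf v < ctx.length) &&
    lk ll ((fun y : ℕ => y.unpair.2)^[ctx.idxOf v] l).unpair.1 a

def Bd (n k : ℕ) : ℕ := Nat.rec 1 (fun _ r => Nat.pair n r) k

def baseDat (n : ℕ) (ll : List (List ℕ)) (ctx : List ℕ) (ψ : ℕ) : Dat :=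
  qstep true (2 ^ (ψ + 1)) (Bd n ctx.length) (fun x => bit x ψ)
    (fun l x y => ball (ψ + 1) fun i => loc (atm ll ctx l) i x y)
    (fairDat (Nat.pair (2 ^ (ψ + 1)) (Bd n ctx.length)) (ψ + 1))

def runStep (n i0 : ℕ) (tl : List (List ℕ)) (S : Dat × ℕ) (it : Bool × ℕ) : Dat × ℕ :=
  (qstep it.1 n (Bd n (S.2 - 1)) (fun p => decide (p = i0)) (fun _ p q => lk tl p q) S.1, S.2 - 1)

def preStep (S : List (Bool × ℕ) × ℕ) : List (Bool × ℕ) × ℕ :=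
  cond (decide (S.2.unpair.1 = 0)) S
    ((decide (S.2.unpair.1 = 1), S.2.unpair.2.unpair.1) :: S.1, S.2.unpair.2.unpair.2)

def pre (c : ℕ) : List (Bool × ℕ) × ℕ := preStep^[c] ([], c)

def answer (n i0 : ℕ) (tl ll : List (List ℕ)) (ctx : List (Bool × ℕ)) (ψ : ℕ) : Bool :=
  fin (ctx.foldl (runStep n i0 tl) (baseDat n ll (ctx.map Prod.snd) ψ, ctx.length)).1

def wrap (φ : HyperLTL) (it : Bool × ℕ) : HyperLTL :=
  match it.1 with
  | true => .ex it.2 φ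
  | false => .all it.2 φ

theorem pre_spec (φ : HyperLTL) : ∀ (N : ℕ) (l : List (Bool × ℕ)), φ.enc ≤ N →
    ∃ (l' : List (Bool × ℕ)) (ψ : QF), preStep^[N] (l, φ.enc) = (l' ++ l, Nat.pair 0 ψ.enc) ∧
      l'.foldl wrap (.qf ψ) = φ := by
  induction φ with
  | qf ψ =>
    intro N l _
    refine ⟨[], ψ, ?_, rfl⟩
    have : preStep (l, HyperLTL.enc (.qf ψ)) = (l, HyperLTL.enc (.qf ψ)) := by
      simp [preStep, HyperLTL.enc]
    rw [Function.iterate_fixed this]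
    rfl
  | ex v φ ih =>
    intro N l hN
    have h1 := Nat.add_le_pair 1 (Nat.pair v φ.enc)
    have h2 := Nat.right_le_pair v φ.enc
    simp only [HyperLTL.enc] at hN
    obtain ⟨N, rfl⟩ : ∃ M, N = M + 1 := ⟨N - 1, by omega⟩
    obtain ⟨l', ψ, e1, e2⟩ := ih N ((true, v) :: l) (by omega)
    refine ⟨l' ++ [(true, v)], ψ, ?_, ?_⟩
    · rw [Function.iterate_succ_apply]
      have : preStep (l, HyperLTL.enc (.ex v φ)) = ((true, v) :: l, φ.enc) := by
        simp [preStep, HyperLTL.enc]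
      rw [this, e1]
      simp
    · rw [List.foldl_append, e2]; rfl
  | all v φ ih =>
    intro N l hN
    have h1 := Nat.add_le_pair 2 (Nat.pair v φ.enc)
    have h2 := Nat.right_le_pair v φ.enc
    simp only [HyperLTL.enc] at hN
    obtain ⟨N, rfl⟩ : ∃ M, N = M + 1 := ⟨N - 1, by omega⟩
    obtain ⟨l', ψ, e1, e2⟩ := ih N ((false, v) :: l) (by omega)
    refine ⟨l' ++ [(false, v)], ψ, ?_, ?_⟩
    · rw [Function.iterate_succ_apply]
      have : preStep (l, HyperLTL.enc (.all v φ)) = ((false, v) :: l, φ.enc) := by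
        simp [preStep, HyperLTL.enc]
      rw [this, e1]
      simp
    · rw [List.foldl_append, e2]; rfl

/-- The trace assignment coded by a word over the product alphabet. -/
def asg (ll : List (List ℕ)) (ctx : List ℕ) (w : ℕ → ℕ) : ℕ → Trace :=
  fun v t => {a | atm ll ctx (w t) a v = true}

theorem asg_cons (ll : List (List ℕ)) (v : ℕ) (ctx : List ℕ) (p w : ℕ → ℕ) :
    asg ll (v :: ctx) (fun t => Nat.pair (p t) (w t)) =
      Function.update (asg ll ctx w) v (fun t => {a | lk ll (p t) a = true}) := by
  funext u t
  by_cases h : u = v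
  · subst h
    simp [asg, atm]
  · ext a
    rw [Function.update_of_ne h]
    simp only [asg, atm, Set.mem_ofPred_eq, List.idxOf_cons_ne _ (Ne.symm h), List.length_cons,
      Function.iterate_succ_apply, Nat.unpair_pair, Nat.succ_eq_add_one, Nat.add_lt_add_iff_right]

def trs (n i0 : ℕ) (tl ll : List (List ℕ)) : Set Trace :=
  {τ | ∃ p : ℕ → ℕ, (∀ t, p t < n) ∧ p 0 = i0 ∧ (∀ t, lk tl (p t) (p (t + 1)) = true) ∧
    τ = fun t => {a | lk ll (p t) a = true}}

theorem run_spec (n i0 : ℕ) (tl ll : List (List ℕ)) (l : List (Bool × ℕ)) :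
    ∀ (φ : HyperLTL) (D : Dat),
    RecogD (Bd n l.length) D
      (fun w => HyperLTL.Sat (trs n i0 tl ll) (asg ll (l.map Prod.snd) w) 0 φ) →
    RecogD 1 (l.foldl (runStep n i0 tl) (D, l.length)).1
      (fun w => HyperLTL.Sat (trs n i0 tl ll) (asg ll [] w) 0 (l.foldl wrap φ)) := by
  induction l with
  | nil => intro φ D H; exact H
  | cons it l ih =>
    intro φ D H
    obtain ⟨b, v⟩ := it
    rw [List.foldl_cons, List.foldl_cons]
    refine ih _ _ ?_
    have hB : ∀ p < n, ∀ x < Bd n l.length, Nat.pair p x < Bd n ((b, v) :: l).length :=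
      fun p hp x hx => pair_lt hp hx
    cases b with
    | true =>
      refine (qstep_ex H hB).congr fun w hw => ?_
      simp only [wrap, HyperLTL.Sat, List.map_cons, asg_cons, decide_eq_true_eq]
      constructor
      · rintro ⟨p, h1, h2, h3, h4⟩
        exact ⟨_, ⟨p, h1, h2, h3, rfl⟩, h4⟩
      · rintro ⟨_, ⟨p, h1, h2, h3, rfl⟩, h4⟩
        exact ⟨p, h1, h2, h3, h4⟩
    | false =>
      refine (qstep_all H hB).congr fun w hw => ?_
      simp only [wrap, HyperLTL.Sat, List.map_cons, asg_cons, decide_eq_true_eq]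
      constructor
      · rintro h _ ⟨p, h1, h2, h3, rfl⟩
        exact h p h1 h2 h3
      · intro h p h1 h2 h3
        exact h _ ⟨p, h1, h2, h3, rfl⟩

theorem answer_spec (n i0 : ℕ) (tl ll : List (List ℕ)) (l : List (Bool × ℕ)) (ψ : QF) :
    answer n i0 tl ll l ψ.enc = true ↔ TSat (trs n i0 tl ll) (l.foldl wrap (.qf ψ)) := by
  have H : RecogD (Bd n l.length) (baseDat n ll (l.map Prod.snd) ψ.enc)
      (fun w => HyperLTL.Sat (trs n i0 tl ll) (asg ll (l.map Prod.snd) w) 0 (.qf ψ)) := by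
    rw [baseDat, List.length_map]
    refine (qstep_ex (fairDat_recog _ _) (fun p hp x hx => pair_lt hp hx)).congr fun w hw => ?_
    have := tableau (asg ll (l.map Prod.snd) w) (fun t => atm ll (l.map Prod.snd) (w t))
      (fun t a v => Iff.rfl) ψ.enc
    rw [dec_enc] at this
    simp only [Nat.unpair_pair]
    exact this
  rw [answer, fin_iff (run_spec n i0 tl ll l _ _ H), TSat]
  have : asg ll [] (fun _ => 0) = fun _ _ => (∅ : Set ℕ) := by
    funext v t
    simp [asg, atm]
  rw [this]

theorem trs_eq (K : FinKripke) :
    trs K.n K.init.val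
      ((List.finRange K.n).map fun s => ((K.trans s).sort (· ≤ ·)).map Fin.val)
      ((List.finRange K.n).map fun s => (K.label s).sort (· ≤ ·)) = K.Traces := by
  have e1 : ∀ (s : Fin K.n) (q : ℕ), lk ((List.finRange K.n).map fun s =>
      ((K.trans s).sort (· ≤ ·)).map Fin.val) s.val q = true ↔ ∃ q' ∈ K.trans s, q'.val = q := by
    intro s q
    rw [lk, memb_iff]
    simp [List.getD]
  have e2 : ∀ (s : Fin K.n) (a : ℕ), lk ((List.finRange K.n).map fun s =>
      (K.label s).sort (· ≤ ·)) s.val a = true ↔ a ∈ K.label s := by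
    intro s q
    rw [lk, memb_iff]
    simp [List.getD]
  ext τ
  constructor
  · rintro ⟨p, h1, h2, h3, rfl⟩
    refine ⟨fun t => ⟨p t, h1 t⟩, ⟨Fin.ext h2, fun t => ?_⟩, ?_⟩
    · obtain ⟨q', hq, hq'⟩ := (e1 ⟨p t, h1 t⟩ _).1 (h3 t)
      have : q' = ⟨p (t + 1), h1 (t + 1)⟩ := Fin.ext hq'
      show (⟨p (t + 1), h1 (t + 1)⟩ : Fin K.n) ∈ K.trans ⟨p t, h1 t⟩
      rw [← this]
      exact hq
    · funext t
      ext a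
      exact e2 ⟨p t, h1 t⟩ a
  · rintro ⟨p, ⟨h1, h2⟩, rfl⟩
    refine ⟨fun t => (p t).val, fun t => (p t).isLt, congrArg Fin.val h1, fun t => ?_, ?_⟩
    · exact (e1 _ _).2 ⟨_, h2 t, rfl⟩
    · funext t
      ext a
      exact (e2 (p t) a).symm

def decL (c : ℕ) : List (List ℕ) := (Encodable.decode (α := List (List ℕ)) c).getD []

def algo (x : ℕ) : Bool :=
  answer x.unpair.1.unpair.1 x.unpair.1.unpair.2.unpair.1
    (decL x.unpair.1.unpair.2.unpair.2.unpair.1) (decL x.unpair.1.unpair.2.unpair.2.unpair.2)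
    (pre x.unpair.2).1 (pre x.unpair.2).2.unpair.2

theorem algo_spec (K : FinKripke) (φ : HyperLTL) :
    algo (Nat.pair K.enc φ.enc) = true ↔ K.Models φ := by
  obtain ⟨l, ψ, h1, h2⟩ := pre_spec φ φ.enc [] le_rfl
  have h3 : pre φ.enc = (l, Nat.pair 0 ψ.enc) := by rw [pre, h1]; simp
  simp only [algo, Nat.unpair_pair, h3, FinKripke.enc, decL, Encodable.encodek, Option.getD_some]
  rw [answer_spec, trs_eq, h2]
  rfl


/-! ### The procedure is primitive recursive -/

section Prim

variable {α β γ : Type} [Primcodable α] [Primcodable β] [Primcodable γ]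

theorem pr_id : Primrec fun a : α => a := Primrec.id

theorem pr_comp {f : α → β} (hf : Primrec f) {u : γ → α} (hu : Primrec u) :
    Primrec fun c => f (u c) := hf.comp hu

theorem pr_fst {f : α → β × γ} (hf : Primrec f) : Primrec fun a => (f a).1 := Primrec.fst.comp hf

theorem pr_snd {f : α → β × γ} (hf : Primrec f) : Primrec fun a => (f a).2 := Primrec.snd.comp hf

theorem pr_pair {f : α → β} {g : α → γ} (hf : Primrec f) (hg : Primrec g) :
    Primrec fun a => (f a, g a) := hf.pair hg

theorem pr_cons {f : α → β} {g : α → List β} (hf : Primrec f) (hg : Primrec g) :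
    Primrec fun a => f a :: g a := Primrec.list_cons.comp hf hg

theorem pr_npair {f g : α → ℕ} (hf : Primrec f) (hg : Primrec g) :
    Primrec fun a => Nat.pair (f a) (g a) := Primrec₂.natPair.comp hf hg

theorem pr_unpair {f : α → ℕ} (hf : Primrec f) : Primrec fun a => (f a).unpair :=
  Primrec.unpair.comp hf

theorem pr_add {f g : α → ℕ} (hf : Primrec f) (hg : Primrec g) :
    Primrec fun a => f a + g a := Primrec.nat_add.comp hf hg

theorem pr_sub {f g : α → ℕ} (hf : Primrec f) (hg : Primrec g) :
    Primrec fun a => f a - g a := Primrec.nat_sub.comp hf hg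

theorem pr_pow {f g : α → ℕ} (hf : Primrec f) (hg : Primrec g) :
    Primrec fun a => f a ^ g a :=
  (Primrec₂.unpaired'.1 Nat.Primrec.pow : Primrec₂ fun m n : ℕ => m ^ n).comp hf hg

theorem pr_and {f g : α → Bool} (hf : Primrec f) (hg : Primrec g) :
    Primrec fun a => f a && g a := Primrec.and.comp hf hg

theorem pr_or {f g : α → Bool} (hf : Primrec f) (hg : Primrec g) :
    Primrec fun a => f a || g a := Primrec.or.comp hf hg

theorem pr_not {f : α → Bool} (hf : Primrec f) : Primrec fun a => !(f a) := Primrec.not.comp hf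

theorem pr_cond {c : α → Bool} {f g : α → β} (hc : Primrec c) (hf : Primrec f) (hg : Primrec g) :
    Primrec fun a => cond (c a) (f a) (g a) := Primrec.cond hc hf hg

theorem pr_beq {f g : α → Bool} (hf : Primrec f) (hg : Primrec g) :
    Primrec fun a => f a == g a := Primrec.beq.comp hf hg

theorem pr_deq {f g : α → ℕ} (hf : Primrec f) (hg : Primrec g) :
    Primrec fun a => decide (f a = g a) :=
  (primrecPred_iff_primrec_decide.1 (Primrec.eq.comp hf hg))

theorem pr_dlt {f g : α → ℕ} (hf : Primrec f) (hg : Primrec g) :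
    Primrec fun a => decide (f a < g a) :=
  (primrecPred_iff_primrec_decide.1 (Primrec.nat_lt.comp hf hg))

theorem pr_dle {f g : α → ℕ} (hf : Primrec f) (hg : Primrec g) :
    Primrec fun a => decide (f a ≤ g a) :=
  (primrecPred_iff_primrec_decide.1 (Primrec.nat_le.comp hf hg))

theorem pr_bit {f g : α → ℕ} (hf : Primrec f) (hg : Primrec g) :
    Primrec fun a => bit (f a) (g a) :=
  pr_deq (Primrec.nat_mod.comp (Primrec.nat_div.comp hf (pr_pow (Primrec.const 2) hg))
    (Primrec.const 2)) (Primrec.const 1)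

theorem pr_rec {n : α → ℕ} {z : α → β} {s : α → ℕ → β → β} (hn : Primrec n) (hz : Primrec z)
    (hs : Primrec fun x : α × ℕ × β => s x.1 x.2.1 x.2.2) :
    Primrec fun a => (Nat.rec (z a) (fun i r => s a i r) (n a) : β) :=
  Primrec.nat_rec' hn hz (h := fun a p => s a p.1 p.2) hs

theorem pr_sub3 {f : α → ℕ → β} (hf : Primrec fun x : α × ℕ => f x.1 x.2) :
    Primrec fun x : α × ℕ × γ => f x.1 x.2.1 :=
  hf.comp (Primrec.fst.pair (Primrec.fst.comp Primrec.snd))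

theorem pr_bex {n : α → ℕ} {f : α → ℕ → Bool} (hn : Primrec n)
    (hf : Primrec fun x : α × ℕ => f x.1 x.2) : Primrec fun a => bex (n a) (f a) :=
  pr_rec (s := fun a i r => r || f a i) hn (Primrec.const false)
    (pr_or (Primrec.snd.comp Primrec.snd) (pr_sub3 hf))

theorem pr_ball {n : α → ℕ} {f : α → ℕ → Bool} (hn : Primrec n)
    (hf : Primrec fun x : α × ℕ => f x.1 x.2) : Primrec fun a => ball (n a) (f a) :=
  pr_rec (s := fun a i r => r && f a i) hn (Primrec.const true)
    (pr_and (Primrec.snd.comp Primrec.snd) (pr_sub3 hf))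

theorem pr_mk {n : α → ℕ} {f : α → ℕ → Bool} (hn : Primrec n)
    (hf : Primrec fun x : α × ℕ => f x.1 x.2) : Primrec fun a => mk (n a) (f a) :=
  pr_rec (s := fun a i r => r + cond (f a i) (2 ^ i) 0) hn (Primrec.const 0)
    (pr_add (Primrec.snd.comp Primrec.snd) (pr_cond (pr_sub3 hf)
      (pr_pow (Primrec.const 2) (Primrec.fst.comp Primrec.snd)) (Primrec.const 0)))

theorem pr_tab {n : α → ℕ} {f : α → ℕ → β} (hn : Primrec n)
    (hf : Primrec fun x : α × ℕ => f x.1 x.2) : Primrec fun a => tab (n a) (f a) :=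
  Primrec.list_map (Primrec.list_range.comp hn) hf

theorem pr_getD (d : β) {l : α → List β} {n : α → ℕ} (hl : Primrec l) (hn : Primrec n) :
    Primrec fun a => (l a).getD (n a) d := (Primrec.list_getD d).comp hl hn

theorem pr_len {l : α → List β} (hl : Primrec l) :
    Primrec fun a => (l a).length := Primrec.list_length.comp hl

theorem pr_idx {l : α → List ℕ} {n : α → ℕ} (hl : Primrec l) (hn : Primrec n) :
    Primrec fun a => (l a).idxOf (n a) := Primrec.list_idxOf.comp hn hl

theorem pr_dm {D : α → Dat} (hD : Primrec D) : Primrec fun a => dm (D a) := pr_fst hD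

theorem pr_dmul {D : α → Dat} {f g : α → ℕ} (hD : Primrec D) (hf : Primrec f) (hg : Primrec g) :
    Primrec fun a => dmul (D a) (f a) (g a) :=
  pr_getD 0 (pr_fst (pr_snd hD)) (pr_npair hf hg)

theorem pr_dh {D : α → Dat} {f : α → ℕ} (hD : Primrec D) (hf : Primrec f) :
    Primrec fun a => dh (D a) (f a) :=
  pr_getD 0 (pr_fst (pr_snd (pr_snd hD))) hf

theorem pr_dP {D : α → Dat} {f g : α → ℕ} (hD : Primrec D) (hf : Primrec f) (hg : Primrec g) :
    Primrec fun a => dP (D a) (f a) (g a) :=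
  pr_getD false (pr_snd (pr_snd (pr_snd hD))) (pr_npair hf hg)

theorem pr_app1 {f : α → ℕ → β} (hf : Primrec fun x : α × ℕ => f x.1 x.2)
    {u : γ → α} {v : γ → ℕ} (hu : Primrec u) (hv : Primrec v) :
    Primrec fun c => f (u c) (v c) := hf.comp (hu.pair hv)

theorem pr_app2 {f : α → ℕ → ℕ → β} (hf : Primrec fun x : α × ℕ × ℕ => f x.1 x.2.1 x.2.2)
    {u : γ → α} {v w : γ → ℕ} (hu : Primrec u) (hv : Primrec v) (hw : Primrec w) :
    Primrec fun c => f (u c) (v c) (w c) := hf.comp (hu.pair (hv.pair hw))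

theorem pr_app3 {f : α → ℕ → ℕ → ℕ → β}
    (hf : Primrec fun x : α × ℕ × ℕ × ℕ => f x.1 x.2.1 x.2.2.1 x.2.2.2)
    {u : γ → α} {v w z : γ → ℕ} (hu : Primrec u) (hv : Primrec v) (hw : Primrec w)
    (hz : Primrec z) :
    Primrec fun c => f (u c) (v c) (w c) (z c) := hf.comp (hu.pair (hv.pair (hw.pair hz)))

theorem pr_mkDat {B m : α → ℕ} {mul : α → ℕ → ℕ → ℕ} {h : α → ℕ → ℕ} {P : α → ℕ → ℕ → Bool}
    (hB : Primrec B) (hm : Primrec m) (hmul : Primrec fun x : α × ℕ × ℕ => mul x.1 x.2.1 x.2.2)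
    (hh : Primrec fun x : α × ℕ => h x.1 x.2)
    (hP : Primrec fun x : α × ℕ × ℕ => P x.1 x.2.1 x.2.2) :
    Primrec fun a => mkDat (B a) (m a) (mul a) (h a) (P a) := by
  unfold mkDat
  repeat' first
    | with_reducible assumption | with_reducible apply pr_app2 hmul | with_reducible apply pr_app1 hh
    | with_reducible apply pr_app2 hP | with_reducible apply Primrec.const _ | with_reducible apply pr_id
    | with_reducible apply pr_npair | with_reducible apply pr_unpair | with_reducible apply pr_bit
    | with_reducible apply pr_and | with_reducible apply pr_or | with_reducible apply pr_not
    | with_reducible apply pr_deq | with_reducible apply pr_dlt | with_reducible apply pr_dle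
    | with_reducible apply pr_beq | with_reducible apply pr_cond | with_reducible apply pr_add
    | with_reducible apply pr_sub | with_reducible apply pr_pow | with_reducible apply pr_bex
    | with_reducible apply pr_ball | with_reducible apply pr_mk | with_reducible apply pr_tab
    | with_reducible apply pr_cons | with_reducible apply pr_getD | with_reducible apply pr_len
    | with_reducible apply pr_idx | with_reducible apply pr_dm | with_reducible apply pr_dmul
    | with_reducible apply pr_dh | with_reducible apply pr_dP | with_reducible apply pr_fst
    | with_reducible apply pr_snd | with_reducible apply pr_pair

theorem pr_pM {n m : α → ℕ} (hn : Primrec n) (hm : Primrec m) :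
    Primrec fun a => pM (n a) (m a) := pr_npair hn (pr_npair hm hn)

theorem pr_pMul {n : α → ℕ} {D : α → Dat} {x y : α → ℕ} (hn : Primrec n) (hD : Primrec D)
    (hx : Primrec x) (hy : Primrec y) :
    Primrec fun a => pMul (n a) (dm (D a)) (dmul (D a)) (x a) (y a) := by
  unfold pMul
  repeat' first
    | with_reducible assumption | with_reducible apply pr_comp hn | with_reducible apply pr_comp hD
    | with_reducible apply pr_comp hx | with_reducible apply pr_comp hy | with_reducible apply pr_pM
    | with_reducible apply Primrec.const _ | with_reducible apply pr_id | with_reducible apply pr_npair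
    | with_reducible apply pr_unpair | with_reducible apply pr_bit | with_reducible apply pr_and
    | with_reducible apply pr_or | with_reducible apply pr_not | with_reducible apply pr_deq
    | with_reducible apply pr_dlt | with_reducible apply pr_dle | with_reducible apply pr_beq
    | with_reducible apply pr_cond | with_reducible apply pr_add | with_reducible apply pr_sub
    | with_reducible apply pr_pow | with_reducible apply pr_bex | with_reducible apply pr_ball
    | with_reducible apply pr_mk | with_reducible apply pr_tab | with_reducible apply pr_cons
    | with_reducible apply pr_getD | with_reducible apply pr_len | with_reducible apply pr_idx
    | with_reducible apply pr_dm | with_reducible apply pr_dmul | with_reducible apply pr_dh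
    | with_reducible apply pr_dP | with_reducible apply pr_fst | with_reducible apply pr_snd
    | with_reducible apply pr_pair

theorem pr_pH {n : α → ℕ} {D : α → Dat} {tr : α → ℕ → ℕ → ℕ → Bool} {x : α → ℕ}
    (hn : Primrec n) (hD : Primrec D)
    (ht : Primrec fun x : α × ℕ × ℕ × ℕ => tr x.1 x.2.1 x.2.2.1 x.2.2.2) (hx : Primrec x) :
    Primrec fun a => pH (n a) (dm (D a)) (dh (D a)) (tr a) (x a) := by
  unfold pH
  repeat' first
    | with_reducible assumption | with_reducible apply pr_comp hn | with_reducible apply pr_comp hD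
    | with_reducible apply pr_comp hx | with_reducible apply pr_app3 ht | with_reducible apply pr_pM
    | with_reducible apply Primrec.const _ | with_reducible apply pr_id | with_reducible apply pr_npair
    | with_reducible apply pr_unpair | with_reducible apply pr_bit | with_reducible apply pr_and
    | with_reducible apply pr_or | with_reducible apply pr_not | with_reducible apply pr_deq
    | with_reducible apply pr_dlt | with_reducible apply pr_dle | with_reducible apply pr_beq
    | with_reducible apply pr_cond | with_reducible apply pr_add | with_reducible apply pr_sub
    | with_reducible apply pr_pow | with_reducible apply pr_bex | with_reducible apply pr_ball
    | with_reducible apply pr_mk | with_reducible apply pr_tab | with_reducible apply pr_cons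
    | with_reducible apply pr_getD | with_reducible apply pr_len | with_reducible apply pr_idx
    | with_reducible apply pr_dm | with_reducible apply pr_dmul | with_reducible apply pr_dh
    | with_reducible apply pr_dP | with_reducible apply pr_fst | with_reducible apply pr_snd
    | with_reducible apply pr_pair

theorem pr_flip {f g : α → Bool} (hf : Primrec f) (hg : Primrec g) :
    Primrec fun a => flip (f a) (g a) := pr_cond hf hg (pr_not hg)

theorem pr_pP {b : α → Bool} {n : α → ℕ} {D : α → Dat} {ini : α → ℕ → Bool} {x y : α → ℕ}
    (hb : Primrec b) (hn : Primrec n) (hD : Primrec D)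
    (hi : Primrec fun x : α × ℕ => ini x.1 x.2) (hx : Primrec x) (hy : Primrec y) :
    Primrec fun a => pP (n a) (dm (D a)) (dmul (D a)) (fun s e => flip (b a) (dP (D a) s e))
      (ini a) (x a) (y a) := by
  unfold pP
  repeat' first
    | with_reducible assumption | with_reducible apply pr_comp hn | with_reducible apply pr_comp hD
    | with_reducible apply pr_comp hx | with_reducible apply pr_comp hy | with_reducible apply pr_comp hb
    | with_reducible apply pr_app1 hi | with_reducible apply pr_flip | with_reducible apply Primrec.const _
    | with_reducible apply pr_id | with_reducible apply pr_npair | with_reducible apply pr_unpair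
    | with_reducible apply pr_bit | with_reducible apply pr_and | with_reducible apply pr_or
    | with_reducible apply pr_not | with_reducible apply pr_deq | with_reducible apply pr_dlt
    | with_reducible apply pr_dle | with_reducible apply pr_beq | with_reducible apply pr_cond
    | with_reducible apply pr_add | with_reducible apply pr_sub | with_reducible apply pr_pow
    | with_reducible apply pr_bex | with_reducible apply pr_ball | with_reducible apply pr_mk
    | with_reducible apply pr_tab | with_reducible apply pr_cons | with_reducible apply pr_getD
    | with_reducible apply pr_len | with_reducible apply pr_idx | with_reducible apply pr_dm
    | with_reducible apply pr_dmul | with_reducible apply pr_dh | with_reducible apply pr_dP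
    | with_reducible apply pr_fst | with_reducible apply pr_snd | with_reducible apply pr_pair

theorem pr_qstep {b : α → Bool} {n B : α → ℕ} {ini : α → ℕ → Bool}
    {tr : α → ℕ → ℕ → ℕ → Bool} {D : α → Dat}
    (hb : Primrec b) (hn : Primrec n) (hB : Primrec B)
    (hi : Primrec fun x : α × ℕ => ini x.1 x.2)
    (ht : Primrec fun x : α × ℕ × ℕ × ℕ => tr x.1 x.2.1 x.2.2.1 x.2.2.2) (hD : Primrec D) :
    Primrec fun a => qstep (b a) (n a) (B a) (ini a) (tr a) (D a) := by
  unfold qstep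
  repeat' first
    | with_reducible assumption | with_reducible apply pr_comp hn | with_reducible apply pr_comp hD
    | with_reducible apply pr_comp hb | with_reducible apply pr_app1 hi | with_reducible apply pr_app3 ht
    | with_reducible apply pr_flip | with_reducible apply pr_mkDat | with_reducible apply pr_pMul
    | with_reducible apply pr_pH | with_reducible apply pr_pP | with_reducible apply pr_pM
    | with_reducible apply Primrec.const _ | with_reducible apply pr_id | with_reducible apply pr_npair
    | with_reducible apply pr_unpair | with_reducible apply pr_bit | with_reducible apply pr_and
    | with_reducible apply pr_or | with_reducible apply pr_not | with_reducible apply pr_deq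
    | with_reducible apply pr_dlt | with_reducible apply pr_dle | with_reducible apply pr_beq
    | with_reducible apply pr_cond | with_reducible apply pr_add | with_reducible apply pr_sub
    | with_reducible apply pr_pow | with_reducible apply pr_bex | with_reducible apply pr_ball
    | with_reducible apply pr_mk | with_reducible apply pr_tab | with_reducible apply pr_cons
    | with_reducible apply pr_getD | with_reducible apply pr_len | with_reducible apply pr_idx
    | with_reducible apply pr_dm | with_reducible apply pr_dmul | with_reducible apply pr_dh
    | with_reducible apply pr_dP | with_reducible apply pr_fst | with_reducible apply pr_snd
    | with_reducible apply pr_pair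

theorem pr_fair {f g : α → ℕ} (hf : Primrec f) (hg : Primrec g) :
    Primrec fun a => fair (f a) (g a) := by
  unfold fair
  repeat' first
    | with_reducible assumption | with_reducible apply Primrec.const _ | with_reducible apply pr_id
    | with_reducible apply pr_npair | with_reducible apply pr_unpair | with_reducible apply pr_bit
    | with_reducible apply pr_and | with_reducible apply pr_or | with_reducible apply pr_not
    | with_reducible apply pr_deq | with_reducible apply pr_dlt | with_reducible apply pr_dle
    | with_reducible apply pr_beq | with_reducible apply pr_cond | with_reducible apply pr_add
    | with_reducible apply pr_sub | with_reducible apply pr_pow | with_reducible apply pr_bex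
    | with_reducible apply pr_ball | with_reducible apply pr_mk | with_reducible apply pr_tab
    | with_reducible apply pr_cons | with_reducible apply pr_getD | with_reducible apply pr_len
    | with_reducible apply pr_idx | with_reducible apply pr_dm | with_reducible apply pr_dmul
    | with_reducible apply pr_dh | with_reducible apply pr_dP | with_reducible apply pr_fst
    | with_reducible apply pr_snd | with_reducible apply pr_pair

theorem pr_fairDat {f g : α → ℕ} (hf : Primrec f) (hg : Primrec g) :
    Primrec fun a => fairDat (f a) (g a) := by
  unfold fairDat
  repeat' first
    | with_reducible assumption | with_reducible apply pr_comp hf | with_reducible apply pr_comp hg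
    | with_reducible apply pr_fair | with_reducible apply pr_mkDat | with_reducible apply Primrec.const _
    | with_reducible apply pr_id | with_reducible apply pr_npair | with_reducible apply pr_unpair
    | with_reducible apply pr_bit | with_reducible apply pr_and | with_reducible apply pr_or
    | with_reducible apply pr_not | with_reducible apply pr_deq | with_reducible apply pr_dlt
    | with_reducible apply pr_dle | with_reducible apply pr_beq | with_reducible apply pr_cond
    | with_reducible apply pr_add | with_reducible apply pr_sub | with_reducible apply pr_pow
    | with_reducible apply pr_bex | with_reducible apply pr_ball | with_reducible apply pr_mk
    | with_reducible apply pr_tab | with_reducible apply pr_cons | with_reducible apply pr_getD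
    | with_reducible apply pr_len | with_reducible apply pr_idx | with_reducible apply pr_dm
    | with_reducible apply pr_dmul | with_reducible apply pr_dh | with_reducible apply pr_dP
    | with_reducible apply pr_fst | with_reducible apply pr_snd | with_reducible apply pr_pair

theorem pr_memb {f : α → List ℕ} {g : α → ℕ} (hf : Primrec f) (hg : Primrec g) :
    Primrec fun a => memb (f a) (g a) := by
  unfold memb
  repeat' first
    | with_reducible assumption | with_reducible apply Primrec.const _ | with_reducible apply pr_id
    | with_reducible apply pr_npair | with_reducible apply pr_unpair | with_reducible apply pr_bit
    | with_reducible apply pr_and | with_reducible apply pr_or | with_reducible apply pr_not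
    | with_reducible apply pr_deq | with_reducible apply pr_dlt | with_reducible apply pr_dle
    | with_reducible apply pr_beq | with_reducible apply pr_cond | with_reducible apply pr_add
    | with_reducible apply pr_sub | with_reducible apply pr_pow | with_reducible apply pr_bex
    | with_reducible apply pr_ball | with_reducible apply pr_mk | with_reducible apply pr_tab
    | with_reducible apply pr_cons | with_reducible apply pr_getD | with_reducible apply pr_len
    | with_reducible apply pr_idx | with_reducible apply pr_dm | with_reducible apply pr_dmul
    | with_reducible apply pr_dh | with_reducible apply pr_dP | with_reducible apply pr_fst
    | with_reducible apply pr_snd | with_reducible apply pr_pair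

theorem pr_lk {l : α → List (List ℕ)} {f g : α → ℕ} (hl : Primrec l) (hf : Primrec f)
    (hg : Primrec g) : Primrec fun a => lk (l a) (f a) (g a) :=
  pr_memb (pr_getD [] hl hf) hg

theorem pr_iter {f g : α → ℕ} (hf : Primrec f) (hg : Primrec g) :
    Primrec fun a => (fun y : ℕ => y.unpair.2)^[f a] (g a) :=
  Primrec.nat_iterate hf hg (h := fun _ y => y.unpair.2)
    (Primrec.to₂ (pr_snd (pr_unpair Primrec.snd)))

theorem pr_atm {ll : α → List (List ℕ)} {ctx : α → List ℕ} {l x v : α → ℕ} (hll : Primrec ll)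
    (hctx : Primrec ctx) (hl : Primrec l) (hx : Primrec x) (hv : Primrec v) :
    Primrec fun a => atm (ll a) (ctx a) (l a) (x a) (v a) := by
  unfold atm
  repeat' first
    | with_reducible assumption | with_reducible apply pr_iter | with_reducible apply pr_lk
    | with_reducible apply Primrec.const _ | with_reducible apply pr_id | with_reducible apply pr_npair
    | with_reducible apply pr_unpair | with_reducible apply pr_bit | with_reducible apply pr_and
    | with_reducible apply pr_or | with_reducible apply pr_not | with_reducible apply pr_deq
    | with_reducible apply pr_dlt | with_reducible apply pr_dle | with_reducible apply pr_beq
    | with_reducible apply pr_cond | with_reducible apply pr_add | with_reducible apply pr_sub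
    | with_reducible apply pr_pow | with_reducible apply pr_bex | with_reducible apply pr_ball
    | with_reducible apply pr_mk | with_reducible apply pr_tab | with_reducible apply pr_cons
    | with_reducible apply pr_getD | with_reducible apply pr_len | with_reducible apply pr_idx
    | with_reducible apply pr_dm | with_reducible apply pr_dmul | with_reducible apply pr_dh
    | with_reducible apply pr_dP | with_reducible apply pr_fst | with_reducible apply pr_snd
    | with_reducible apply pr_pair

theorem pr_loc {ll : α → List (List ℕ)} {ctx : α → List ℕ} {l i x y : α → ℕ} (hll : Primrec ll)
    (hctx : Primrec ctx) (hl : Primrec l) (hi : Primrec i) (hx : Primrec x) (hy : Primrec y) :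
    Primrec fun a => loc (atm (ll a) (ctx a) (l a)) (i a) (x a) (y a) := by
  unfold loc
  repeat' first
    | with_reducible assumption | with_reducible apply pr_atm | with_reducible apply Primrec.const _
    | with_reducible apply pr_id | with_reducible apply pr_npair | with_reducible apply pr_unpair
    | with_reducible apply pr_bit | with_reducible apply pr_and | with_reducible apply pr_or
    | with_reducible apply pr_not | with_reducible apply pr_deq | with_reducible apply pr_dlt
    | with_reducible apply pr_dle | with_reducible apply pr_beq | with_reducible apply pr_cond
    | with_reducible apply pr_add | with_reducible apply pr_sub | with_reducible apply pr_pow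
    | with_reducible apply pr_bex | with_reducible apply pr_ball | with_reducible apply pr_mk
    | with_reducible apply pr_tab | with_reducible apply pr_cons | with_reducible apply pr_getD
    | with_reducible apply pr_len | with_reducible apply pr_idx | with_reducible apply pr_dm
    | with_reducible apply pr_dmul | with_reducible apply pr_dh | with_reducible apply pr_dP
    | with_reducible apply pr_fst | with_reducible apply pr_snd | with_reducible apply pr_pair

theorem pr_Bd {n k : α → ℕ} (hn : Primrec n) (hk : Primrec k) :
    Primrec fun a => Bd (n a) (k a) :=
  pr_rec (s := fun a _ r => Nat.pair (n a) r) hk (Primrec.const 1)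
    (pr_npair (pr_comp hn Primrec.fst) (Primrec.snd.comp Primrec.snd))

theorem pr_baseDat {n : α → ℕ} {ll : α → List (List ℕ)} {ctx : α → List ℕ} {f : α → ℕ}
    (hn : Primrec n) (hll : Primrec ll) (hctx : Primrec ctx) (hf : Primrec f) :
    Primrec fun a => baseDat (n a) (ll a) (ctx a) (f a) := by
  unfold baseDat
  repeat' first
    | with_reducible assumption | with_reducible apply pr_qstep | with_reducible apply pr_Bd
    | with_reducible apply pr_fairDat | with_reducible apply pr_comp hn | with_reducible apply pr_comp hf
    | with_reducible apply pr_comp hll | with_reducible apply pr_comp hctx | with_reducible apply pr_loc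
    | with_reducible apply Primrec.const _ | with_reducible apply pr_id | with_reducible apply pr_npair
    | with_reducible apply pr_unpair | with_reducible apply pr_bit | with_reducible apply pr_and
    | with_reducible apply pr_or | with_reducible apply pr_not | with_reducible apply pr_deq
    | with_reducible apply pr_dlt | with_reducible apply pr_dle | with_reducible apply pr_beq
    | with_reducible apply pr_cond | with_reducible apply pr_add | with_reducible apply pr_sub
    | with_reducible apply pr_pow | with_reducible apply pr_bex | with_reducible apply pr_ball
    | with_reducible apply pr_mk | with_reducible apply pr_tab | with_reducible apply pr_cons
    | with_reducible apply pr_getD | with_reducible apply pr_len | with_reducible apply pr_idx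
    | with_reducible apply pr_dm | with_reducible apply pr_dmul | with_reducible apply pr_dh
    | with_reducible apply pr_dP | with_reducible apply pr_fst | with_reducible apply pr_snd
    | with_reducible apply pr_pair

theorem pr_runStep {n i : α → ℕ} {tl : α → List (List ℕ)} {S : α → Dat × ℕ} {t : α → Bool × ℕ}
    (hn : Primrec n) (hi : Primrec i) (htl : Primrec tl) (hS : Primrec S) (ht : Primrec t) :
    Primrec fun a => runStep (n a) (i a) (tl a) (S a) (t a) := by
  unfold runStep
  repeat' first
    | with_reducible assumption | with_reducible apply pr_qstep | with_reducible apply pr_Bd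
    | with_reducible apply pr_lk | with_reducible apply pr_comp hn | with_reducible apply pr_comp hi
    | with_reducible apply pr_comp htl | with_reducible apply pr_comp hS | with_reducible apply pr_comp ht
    | with_reducible apply Primrec.const _ | with_reducible apply pr_id | with_reducible apply pr_npair
    | with_reducible apply pr_unpair | with_reducible apply pr_bit | with_reducible apply pr_and
    | with_reducible apply pr_or | with_reducible apply pr_not | with_reducible apply pr_deq
    | with_reducible apply pr_dlt | with_reducible apply pr_dle | with_reducible apply pr_beq
    | with_reducible apply pr_cond | with_reducible apply pr_add | with_reducible apply pr_sub
    | with_reducible apply pr_pow | with_reducible apply pr_bex | with_reducible apply pr_ball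
    | with_reducible apply pr_mk | with_reducible apply pr_tab | with_reducible apply pr_cons
    | with_reducible apply pr_getD | with_reducible apply pr_len | with_reducible apply pr_idx
    | with_reducible apply pr_dm | with_reducible apply pr_dmul | with_reducible apply pr_dh
    | with_reducible apply pr_dP | with_reducible apply pr_fst | with_reducible apply pr_snd
    | with_reducible apply pr_pair

theorem pr_preStep : Primrec preStep := by
  unfold preStep
  repeat' first
    | with_reducible assumption | with_reducible apply Primrec.fst | with_reducible apply Primrec.snd
    | with_reducible apply Primrec.const _ | with_reducible apply pr_id | with_reducible apply pr_npair
    | with_reducible apply pr_unpair | with_reducible apply pr_bit | with_reducible apply pr_and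
    | with_reducible apply pr_or | with_reducible apply pr_not | with_reducible apply pr_deq
    | with_reducible apply pr_dlt | with_reducible apply pr_dle | with_reducible apply pr_beq
    | with_reducible apply pr_cond | with_reducible apply pr_add | with_reducible apply pr_sub
    | with_reducible apply pr_pow | with_reducible apply pr_bex | with_reducible apply pr_ball
    | with_reducible apply pr_mk | with_reducible apply pr_tab | with_reducible apply pr_cons
    | with_reducible apply pr_getD | with_reducible apply pr_len | with_reducible apply pr_idx
    | with_reducible apply pr_dm | with_reducible apply pr_dmul | with_reducible apply pr_dh
    | with_reducible apply pr_dP | with_reducible apply pr_fst | with_reducible apply pr_snd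
    | with_reducible apply pr_pair

theorem pr_pre {f : α → ℕ} (hf : Primrec f) : Primrec fun a => pre (f a) :=
  Primrec.nat_iterate hf (pr_pair (Primrec.const []) hf) (h := fun _ S => preStep S)
    (Primrec.to₂ (pr_preStep.comp Primrec.snd))

theorem pr_fin {D : α → Dat} (hD : Primrec D) : Primrec fun a => fin (D a) := by
  unfold fin
  repeat' first
    | with_reducible assumption | with_reducible apply pr_comp hD | with_reducible apply Primrec.const _
    | with_reducible apply pr_id | with_reducible apply pr_npair | with_reducible apply pr_unpair
    | with_reducible apply pr_bit | with_reducible apply pr_and | with_reducible apply pr_or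
    | with_reducible apply pr_not | with_reducible apply pr_deq | with_reducible apply pr_dlt
    | with_reducible apply pr_dle | with_reducible apply pr_beq | with_reducible apply pr_cond
    | with_reducible apply pr_add | with_reducible apply pr_sub | with_reducible apply pr_pow
    | with_reducible apply pr_bex | with_reducible apply pr_ball | with_reducible apply pr_mk
    | with_reducible apply pr_tab | with_reducible apply pr_cons | with_reducible apply pr_getD
    | with_reducible apply pr_len | with_reducible apply pr_idx | with_reducible apply pr_dm
    | with_reducible apply pr_dmul | with_reducible apply pr_dh | with_reducible apply pr_dP
    | with_reducible apply pr_fst | with_reducible apply pr_snd | with_reducible apply pr_pair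

theorem pr_answer {n i : α → ℕ} {tl ll : α → List (List ℕ)} {ctx : α → List (Bool × ℕ)}
    {f : α → ℕ} (hn : Primrec n) (hi : Primrec i) (htl : Primrec tl) (hll : Primrec ll)
    (hctx : Primrec ctx) (hf : Primrec f) :
    Primrec fun a => answer (n a) (i a) (tl a) (ll a) (ctx a) (f a) := by
  have h1 : Primrec fun a => (ctx a).map Prod.snd :=
    Primrec.list_map hctx (g := fun _ x => x.2) (Primrec.to₂ (Primrec.snd.comp Primrec.snd))
  have h2 : Primrec fun x : α × (Dat × ℕ) × (Bool × ℕ) =>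
      runStep (n x.1) (i x.1) (tl x.1) x.2.1 x.2.2 :=
    pr_runStep (pr_comp hn Primrec.fst) (pr_comp hi Primrec.fst) (pr_comp htl Primrec.fst)
      (pr_fst Primrec.snd) (pr_snd Primrec.snd)
  exact pr_fin (pr_fst (Primrec.list_foldl (h := fun a x => runStep (n a) (i a) (tl a) x.1 x.2)
    hctx (pr_pair (pr_baseDat hn hll h1 hf) (pr_len hctx)) h2))

theorem pr_decL {f : α → ℕ} (hf : Primrec f) : Primrec fun a => decL (f a) :=
  Primrec.option_getD.comp (Primrec.decode.comp hf) (Primrec.const [])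

theorem pr_algo : Primrec algo := by
  unfold algo
  repeat' first
    | with_reducible assumption | with_reducible apply pr_answer | with_reducible apply pr_decL
    | with_reducible apply pr_pre | with_reducible apply Primrec.const _ | with_reducible apply pr_id
    | with_reducible apply pr_npair | with_reducible apply pr_unpair | with_reducible apply pr_bit
    | with_reducible apply pr_and | with_reducible apply pr_or | with_reducible apply pr_not
    | with_reducible apply pr_deq | with_reducible apply pr_dlt | with_reducible apply pr_dle
    | with_reducible apply pr_beq | with_reducible apply pr_cond | with_reducible apply pr_add
    | with_reducible apply pr_sub | with_reducible apply pr_pow | with_reducible apply pr_bex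
    | with_reducible apply pr_ball | with_reducible apply pr_mk | with_reducible apply pr_tab
    | with_reducible apply pr_cons | with_reducible apply pr_getD | with_reducible apply pr_len
    | with_reducible apply pr_idx | with_reducible apply pr_dm | with_reducible apply pr_dmul
    | with_reducible apply pr_dh | with_reducible apply pr_dP | with_reducible apply pr_fst
    | with_reducible apply pr_snd | with_reducible apply pr_pair

end Prim

end HMC

/-- **The HyperLTL model checking problem is decidable**: there is a computable
(total) function that, given (the encoding of) a finite Kripke structure `K`
and a HyperLTL sentence `φ`, decides whether `K ⊨ φ`. -/
theorem hyperLTL_model_checking_decidable :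
    ∃ f : ℕ → Bool, Computable f ∧
      ∀ (K : FinKripke) (φ : HyperLTL), φ.Closed →
        (f (Nat.pair K.enc φ.enc) = true ↔ K.Models φ) :=
  ⟨HMC.algo, HMC.pr_algo.to_comp, fun K φ _ => HMC.algo_spec K φ⟩
end

section
/- HyperQCTL* is strictly more expressive than HyperCTL* over Kripke structures: every HyperCTL* sentence is a HyperQCTL* sentence, and in particular the knowledge operator of HyperKCTL* is expressible in HyperQCTL* but some HyperQCTL* sentence has no equivalent HyperCTL* sentence. -/
/-!
STATEMENT 17: HyperQCTL* is strictly more expressive than HyperCTL* over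
Kripke structures: every HyperCTL* sentence is a HyperQCTL* sentence, and in
particular the knowledge operator of HyperKCTL* is expressible in HyperQCTL*
but some HyperQCTL* sentence has no equivalent HyperCTL* sentence.
-/

/-- A Kripke structure: a set of states, an initial state, a transition
function with nonempty successor sets, and a state labeling over the atomic
propositions (drawn from `ℕ`). -/
structure Kripke where
  State : Type
  init : State
  trans : State → Set State
  trans_nonempty : ∀ s, (trans s).Nonempty
  label : State → Set ℕ

/-- Paths of `K` starting in state `s`. -/
def Kripke.PathFrom (K : Kripke) (s : K.State) (p : ℕ → K.State) : Prop :=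
  p 0 = s ∧ ∀ i, p (i + 1) ∈ K.trans (p i)

/-- Paths of `K` starting in the initial state. -/
def Kripke.IsPath (K : Kripke) (p : ℕ → K.State) : Prop :=
  K.PathFrom K.init p

/-! ### HyperCTL* -/

/-- HyperCTL* formulas: `a_π | ¬φ | φ ∨ φ | X φ | φ U φ | ∃π.φ`. -/
inductive HCTL : Type
  | atom : ℕ → ℕ → HCTL          -- `a_π` (proposition, path variable)
  | not : HCTL → HCTL
  | or : HCTL → HCTL → HCTL
  | next : HCTL → HCTL
  | xuntil : HCTL → HCTL → HCTL
  | ex : ℕ → HCTL → HCTL         -- `∃π.φ`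

/-- Satisfaction `K, Π, i ⊨ φ` of a HyperCTL* formula: `Pi` assigns path
variables to paths of `K`, and `cur` is the path assigned to the special
variable `ε` denoting the most recently quantified path. -/
def HCTL.Sat (K : Kripke) :
    (ℕ → (ℕ → K.State)) → (ℕ → K.State) → ℕ → HCTL → Prop
  | Pi, _, i, .atom a π => a ∈ K.label (Pi π i)
  | Pi, cur, i, .not φ => ¬ HCTL.Sat K Pi cur i φ
  | Pi, cur, i, .or φ₁ φ₂ => HCTL.Sat K Pi cur i φ₁ ∨ HCTL.Sat K Pi cur i φ₂
  | Pi, cur, i, .next φ => HCTL.Sat K Pi cur (i + 1) φ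
  | Pi, cur, i, .xuntil φ₁ φ₂ =>
      ∃ k, i ≤ k ∧ HCTL.Sat K Pi cur k φ₂ ∧
        ∀ j, i ≤ j → j < k → HCTL.Sat K Pi cur j φ₁
  | Pi, cur, i, .ex π φ =>
      ∃ p : ℕ → K.State, K.PathFrom (cur i) p ∧
        HCTL.Sat K (Function.update Pi π p) p i φ

/-- Free path variables of a HyperCTL* formula. -/
def HCTL.free : HCTL → Finset ℕ
  | .atom _ π => {π}
  | .not φ => φ.free
  | .or φ₁ φ₂ => φ₁.free ∪ φ₂.free
  | .next φ => φ.free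
  | .xuntil φ₁ φ₂ => φ₁.free ∪ φ₂.free
  | .ex π φ => φ.free \ {π}

/-- Temporal operators occur only inside the scope of path quantifiers. -/
def HCTL.Guarded : HCTL → Bool → Prop
  | .atom _ _, _ => True
  | .not φ, b => HCTL.Guarded φ b
  | .or φ₁ φ₂, b => HCTL.Guarded φ₁ b ∧ HCTL.Guarded φ₂ b
  | .next φ, b => b = true ∧ HCTL.Guarded φ b
  | .xuntil φ₁ φ₂, b => b = true ∧ HCTL.Guarded φ₁ b ∧ HCTL.Guarded φ₂ b
  | .ex _ φ, _ => HCTL.Guarded φ true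

/-- A HyperCTL* sentence. -/
def HCTL.Sentence (φ : HCTL) : Prop := φ.free = ∅ ∧ φ.Guarded false

/-- `K ⊨ φ` iff `K, ∅, 0 ⊨ φ`. -/
def Kripke.ModelsC (K : Kripke) (φ : HCTL) : Prop :=
  HCTL.Sat K (fun _ _ => K.init) (fun _ => K.init) 0 φ

/-! ### HyperKCTL* -/

/-- HyperKCTL* formulas: HyperCTL* extended with the knowledge operator
`K_{A,π} φ`. -/
inductive HKC : Type
  | atom : ℕ → ℕ → HKC           -- `a_π` (proposition, path variable)
  | not : HKC → HKC
  | or : HKC → HKC → HKC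
  | next : HKC → HKC
  | xuntil : HKC → HKC → HKC
  | ex : ℕ → HKC → HKC           -- `∃π.φ`
  | know : Finset ℕ → ℕ → HKC → HKC   -- `K_{A,π} φ`

/-- Satisfaction `K, Π, i ⊨ φ` of a HyperKCTL* formula: `K_{A,π} φ` holds at
position `i` iff for all paths `p` of `K` starting in the initial state whose
prefix up to `i` agrees with `Π(π)` on all propositions in `A`, `φ` holds
with `π` remapped to `p`. -/
def HKC.Sat (K : Kripke) :
    (ℕ → (ℕ → K.State)) → (ℕ → K.State) → ℕ → HKC → Prop
  | Pi, _, i, .atom a π => a ∈ K.label (Pi π i)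
  | Pi, cur, i, .not φ => ¬ HKC.Sat K Pi cur i φ
  | Pi, cur, i, .or φ₁ φ₂ => HKC.Sat K Pi cur i φ₁ ∨ HKC.Sat K Pi cur i φ₂
  | Pi, cur, i, .next φ => HKC.Sat K Pi cur (i + 1) φ
  | Pi, cur, i, .xuntil φ₁ φ₂ =>
      ∃ k, i ≤ k ∧ HKC.Sat K Pi cur k φ₂ ∧
        ∀ j, i ≤ j → j < k → HKC.Sat K Pi cur j φ₁
  | Pi, cur, i, .ex π φ =>
      ∃ p : ℕ → K.State, K.PathFrom (cur i) p ∧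
        HKC.Sat K (Function.update Pi π p) p i φ
  | Pi, cur, i, .know A π φ =>
      ∀ p : ℕ → K.State, K.IsPath p →
        (∀ a ∈ A, ∀ j ≤ i, (a ∈ K.label (Pi π j) ↔ a ∈ K.label (p j))) →
        HKC.Sat K (Function.update Pi π p) cur i φ

/-- Free path variables of a HyperKCTL* formula. -/
def HKC.free : HKC → Finset ℕ
  | .atom _ π => {π}
  | .not φ => φ.free
  | .or φ₁ φ₂ => φ₁.free ∪ φ₂.free
  | .next φ => φ.free
  | .xuntil φ₁ φ₂ => φ₁.free ∪ φ₂.free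
  | .ex π φ => φ.free \ {π}
  | .know _ π φ => insert π φ.free

/-- Temporal operators occur only inside the scope of path quantifiers. -/
def HKC.Guarded : HKC → Bool → Prop
  | .atom _ _, _ => True
  | .not φ, b => HKC.Guarded φ b
  | .or φ₁ φ₂, b => HKC.Guarded φ₁ b ∧ HKC.Guarded φ₂ b
  | .next φ, b => b = true ∧ HKC.Guarded φ b
  | .xuntil φ₁ φ₂, b => b = true ∧ HKC.Guarded φ₁ b ∧ HKC.Guarded φ₂ b
  | .ex _ φ, _ => HKC.Guarded φ true
  | .know _ _ φ, b => HKC.Guarded φ b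

/-- A HyperKCTL* sentence. -/
def HKC.Sentence (φ : HKC) : Prop := φ.free = ∅ ∧ φ.Guarded false

/-- `K ⊨ φ` iff `K, ∅, 0 ⊨ φ`. -/
def Kripke.ModelsK (K : Kripke) (φ : HKC) : Prop :=
  HKC.Sat K (fun _ _ => K.init) (fun _ => K.init) 0 φ

/-! ### HyperQCTL* -/

/-- The labeling of `K` extended to finite state sequences (evaluating the
last state). -/
def Kripke.seqLabel' (K : Kripke) (l : List K.State) : Set ℕ :=
  match l.getLast? with
  | some s => K.label s
  | none => ∅

/-- HyperQCTL* formulas: `a_π | ¬φ | φ ∨ φ | X φ | φ U φ | ∃π.φ | ∃q.φ`. -/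
inductive HQC : Type
  | atom : ℕ → ℕ → HQC           -- `a_π` (proposition, path variable)
  | not : HQC → HQC
  | or : HQC → HQC → HQC
  | next : HQC → HQC
  | xuntil : HQC → HQC → HQC
  | ex : ℕ → HQC → HQC           -- `∃π.φ`
  | pex : ℕ → HQC → HQC          -- `∃q.φ` (propositional quantification)

/-- Satisfaction `K, Π, i ⊨ φ` of a HyperQCTL* formula: `L` is the current
labeling `S* → 2^AP` of the computation tree (initially the labeling of `K`),
`Pi` assigns path variables to paths of `K`, and `cur` is the most recently
quantified path. A propositional quantifier `∃q.φ` introduces a fresh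
labeling `L'` agreeing with `L` on all propositions other than `q`. -/
def HQC.Sat (K : Kripke) :
    (List K.State → Set ℕ) → (ℕ → (ℕ → K.State)) → (ℕ → K.State) → ℕ →
      HQC → Prop
  | L, Pi, _, i, .atom a π => a ∈ L ((List.range (i + 1)).map (Pi π))
  | L, Pi, cur, i, .not φ => ¬ HQC.Sat K L Pi cur i φ
  | L, Pi, cur, i, .or φ₁ φ₂ =>
      HQC.Sat K L Pi cur i φ₁ ∨ HQC.Sat K L Pi cur i φ₂
  | L, Pi, cur, i, .next φ => HQC.Sat K L Pi cur (i + 1) φ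
  | L, Pi, cur, i, .xuntil φ₁ φ₂ =>
      ∃ k, i ≤ k ∧ HQC.Sat K L Pi cur k φ₂ ∧
        ∀ j, i ≤ j → j < k → HQC.Sat K L Pi cur j φ₁
  | L, Pi, cur, i, .ex π φ =>
      ∃ p : ℕ → K.State, K.PathFrom (cur i) p ∧
        HQC.Sat K L (Function.update Pi π p) p i φ
  | L, Pi, cur, i, .pex q φ =>
      ∃ L' : List K.State → Set ℕ,
        (∀ w, ∀ b, b ≠ q → (b ∈ L' w ↔ b ∈ L w)) ∧
        HQC.Sat K L' Pi cur i φ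

/-- Free path variables of a HyperQCTL* formula. -/
def HQC.free : HQC → Finset ℕ
  | .atom _ π => {π}
  | .not φ => φ.free
  | .or φ₁ φ₂ => φ₁.free ∪ φ₂.free
  | .next φ => φ.free
  | .xuntil φ₁ φ₂ => φ₁.free ∪ φ₂.free
  | .ex π φ => φ.free \ {π}
  | .pex _ φ => φ.free

/-- Temporal operators occur only inside the scope of path quantifiers. -/
def HQC.Guarded : HQC → Bool → Prop
  | .atom _ _, _ => True
  | .not φ, b => HQC.Guarded φ b
  | .or φ₁ φ₂, b => HQC.Guarded φ₁ b ∧ HQC.Guarded φ₂ b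
  | .next φ, b => b = true ∧ HQC.Guarded φ b
  | .xuntil φ₁ φ₂, b => b = true ∧ HQC.Guarded φ₁ b ∧ HQC.Guarded φ₂ b
  | .ex _ φ, _ => HQC.Guarded φ true
  | .pex _ φ, b => HQC.Guarded φ b

/-- A HyperQCTL* sentence. -/
def HQC.Sentence (φ : HQC) : Prop := φ.free = ∅ ∧ φ.Guarded false

/-- `K ⊨ φ` iff `K, ∅, 0 ⊨ φ` with the original labeling of `K`. -/
def Kripke.ModelsQ (K : Kripke) (φ : HQC) : Prop :=
  HQC.Sat K K.seqLabel' (fun _ _ => K.init) (fun _ => K.init) 0 φ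

/-- The syntactic embedding of HyperCTL* into HyperQCTL*. -/
def HCTL.toHQC : HCTL → HQC
  | .atom a π => .atom a π
  | .not φ => .not φ.toHQC
  | .or φ₁ φ₂ => .or φ₁.toHQC φ₂.toHQC
  | .next φ => .next φ.toHQC
  | .xuntil φ₁ φ₂ => .xuntil φ₁.toHQC φ₂.toHQC
  | .ex π φ => .ex π φ.toHQC


/-! ## Helper material -/

/-- Length `k+1` prefix of a path. -/
def pre {S : Type} (p : ℕ → S) (k : ℕ) : List S := (List.range (k + 1)).map p

theorem pre_inj {S : Type} {p q : ℕ → S} {k m : ℕ} :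
    pre p k = pre q m ↔ k = m ∧ ∀ j ≤ k, p j = q j := by
  constructor
  · intro h
    have hl := congrArg List.length h
    simp [pre] at hl
    subst hl
    refine ⟨rfl, fun j hj => ?_⟩
    simp only [pre] at h
    exact (List.map_inj_left.1 h) j (by simp; omega)
  · rintro ⟨rfl, h⟩
    simp only [pre]
    exact List.map_inj_left.2 (fun j hj => h j (by simp at hj; omega))

theorem seqLabel_pre (K : Kripke) (p : ℕ → K.State) (k : ℕ) :
    K.seqLabel' (pre p k) = K.label (p k) := by
  simp [Kripke.seqLabel', pre, List.range_succ]

theorem exists_path (K : Kripke) (s : K.State) : ∃ p, K.PathFrom s p := by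
  choose f hf using K.trans_nonempty
  refine ⟨fun n => f^[n] s, rfl, fun i => ?_⟩
  simp only [Function.iterate_succ_apply']
  exact hf _

/-! ### Part 1 -/

theorem toHQC_free (φ : HCTL) : φ.toHQC.free = φ.free := by
  induction φ <;> simp_all [HCTL.toHQC, HCTL.free, HQC.free]

theorem toHQC_guarded (φ : HCTL) : ∀ b, φ.toHQC.Guarded b ↔ φ.Guarded b := by
  induction φ <;> simp_all [HCTL.toHQC, HCTL.Guarded, HQC.Guarded]

theorem toHQC_sat (K : Kripke) (φ : HCTL) : ∀ Pi cur i,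
    HCTL.Sat K Pi cur i φ ↔ HQC.Sat K K.seqLabel' Pi cur i φ.toHQC := by
  induction φ with
  | atom a π =>
    intro Pi cur i
    have := seqLabel_pre K (Pi π) i
    simp only [pre] at this
    simp only [HCTL.toHQC, HCTL.Sat, HQC.Sat, this]
  | not φ ih => intro Pi cur i; simp only [HCTL.toHQC, HCTL.Sat, HQC.Sat, ih]
  | or φ ψ ih1 ih2 => intro Pi cur i; simp only [HCTL.toHQC, HCTL.Sat, HQC.Sat, ih1, ih2]
  | next φ ih => intro Pi cur i; simp only [HCTL.toHQC, HCTL.Sat, HQC.Sat, ih]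
  | xuntil φ ψ ih1 ih2 => intro Pi cur i; simp only [HCTL.toHQC, HCTL.Sat, HQC.Sat, ih1, ih2]
  | ex π φ ih => intro Pi cur i; simp only [HCTL.toHQC, HCTL.Sat, HQC.Sat, ih]

/-! ### Part 3 -/

theorem unlabeled_sat (K K' : Kripke) (h : ∀ s, K.label s = ∅) (h' : ∀ s, K'.label s = ∅)
    (φ : HCTL) : ∀ Pi cur i Pi' cur', HCTL.Sat K Pi cur i φ ↔ HCTL.Sat K' Pi' cur' i φ := by
  induction φ with
  | atom a π => intro Pi cur i Pi' cur'; simp [HCTL.Sat, h, h']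
  | not φ ih => intro Pi cur i Pi' cur'; simp only [HCTL.Sat]; rw [ih]
  | or φ ψ ih1 ih2 => intro Pi cur i Pi' cur'; simp only [HCTL.Sat]; rw [ih1, ih2]
  | next φ ih => intro Pi cur i Pi' cur'; simp only [HCTL.Sat]; rw [ih]
  | xuntil φ ψ ih1 ih2 =>
    intro Pi cur i Pi' cur'; simp only [HCTL.Sat]
    simp only [fun k => ih1 Pi cur k Pi' cur', fun k => ih2 Pi cur k Pi' cur']
  | ex π φ ih =>
    intro Pi cur i Pi' cur'; simp only [HCTL.Sat]
    constructor
    · rintro ⟨p, hp, hs⟩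
      obtain ⟨q, hq⟩ := exists_path K' (cur' i)
      exact ⟨q, hq, (ih _ _ _ _ _).1 hs⟩
    · rintro ⟨p, hp, hs⟩
      obtain ⟨q, hq⟩ := exists_path K (cur i)
      exact ⟨q, hq, (ih _ _ _ _ _).2 hs⟩

def K1 : Kripke where
  State := Unit
  init := ()
  trans _ := Set.univ
  trans_nonempty _ := ⟨(), trivial⟩
  label _ := ∅

def K2 : Kripke where
  State := Bool
  init := true
  trans _ := Set.univ
  trans_nonempty _ := ⟨true, trivial⟩
  label _ := ∅

def psi3 : HQC :=
  .pex 0 (.ex 0 (.ex 1 (.next (.not (.or (.not (.atom 0 0)) (.atom 0 1))))))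

theorem psi3_sentence : psi3.Sentence := by
  refine ⟨?_, ?_⟩
  · simp only [psi3, HQC.free]; decide
  · simp [psi3, HQC.Guarded]

theorem psi3_K1 : ¬ K1.ModelsQ psi3 := by
  simp only [Kripke.ModelsQ, psi3, HQC.Sat]
  rintro ⟨L', -, p, -, q, -, h⟩
  apply h
  have : ∀ p q : ℕ → K1.State, p = q := fun p q => by funext k; exact Subsingleton.elim (α := Unit) _ _
  rw [this (Function.update (Function.update (fun _ _ => K1.init) 0 p) 1 q 0)
    (Function.update (Function.update (fun _ _ => K1.init) 0 p) 1 q 1)]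
  exact (em _).symm

theorem psi3_K2 : K2.ModelsQ psi3 := by
  simp only [Kripke.ModelsQ, psi3, HQC.Sat]
  refine ⟨fun w => {b | b = 0 ∧ w = [true, true]}, ?_, fun _ => true, ⟨rfl, fun _ => trivial⟩,
    fun n => decide (n = 0), ⟨rfl, fun _ => trivial⟩, ?_⟩
  · intro w b hb
    have hw : K2.seqLabel' w = ∅ := by
      unfold Kripke.seqLabel'
      split <;> rfl
    rw [hw]
    simp [hb]
  · have h1 : (List.range (0 + 1 + 1)).map (fun _ : ℕ => true) = [true, true] := by decide
    have h2 : (List.range (0 + 1 + 1)).map (fun n : ℕ => decide (n = 0)) ≠ [true, true] := by decide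
    rw [not_or, not_not]
    exact ⟨⟨rfl, h1⟩, fun h => h2 h.2⟩

/-! ### Addition of times -/

/-- `p` is an admissible ray at time `c`. -/
def Row (K : Kripke) (β : ℕ → K.State) (S X : Set (List K.State)) (c : ℕ)
    (p : ℕ → K.State) : Prop :=
  K.PathFrom (β c) p ∧ ∃ n, c ≤ n ∧ (pre p n ∈ S ∧ pre p (n + 1) ∈ X) ∧
    ∀ k, c ≤ k → k < n → pre p k ∉ S

def AddSem (K : Kripke) (r i w : ℕ) : Prop :=
  ∀ β, K.IsPath β → ∀ S X E : Set (List K.State),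
    (∀ c, ∃ p, Row K β S X c p) →
    (∀ p, Row K β S X 0 p → pre p r ∈ E) →
    (∀ k c, (∃ p, Row K β S X c p ∧ c ≤ k ∧ pre p k ∈ E) →
      ∀ p, Row K β S X (c + 1) p → pre p (k + 1) ∈ E) →
    ∃ p, Row K β S X i p ∧ i ≤ w ∧ pre p w ∈ E

theorem AddSem.complete (K : Kripke) (r i : ℕ) : AddSem K r i (r + i) := by
  intro β hβ S X E h1 h2 h3
  have : ∀ c p, Row K β S X c p → pre p (r + c) ∈ E := by
    intro c
    induction c with
    | zero => exact h2
    | succ c ih =>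
      obtain ⟨q, hq⟩ := h1 c
      exact h3 (r + c) c ⟨q, hq, by omega, ih q hq⟩
  obtain ⟨p, hp⟩ := h1 i
  exact ⟨p, hp, by omega, this i p hp⟩

/-- `s` can be reached from `t` in `n` steps. -/
def ReachIn (K : Kripke) (s : K.State) : ℕ → K.State → Prop
  | 0, t => t = s
  | n + 1, t => ∃ t' ∈ K.trans t, ReachIn K s n t'

theorem reachIn_path (K : Kripke) (p : ℕ → K.State) (hp : ∀ i, p (i + 1) ∈ K.trans (p i)) :
    ∀ n j, ReachIn K (p (j + n)) n (p j) := by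
  intro n
  induction n with
  | zero => intro j; rfl
  | succ n ih =>
    intro j
    refine ⟨p (j + 1), hp j, ?_⟩
    have := ih (j + 1)
    rwa [show j + 1 + n = j + (n + 1) by omega] at this

theorem exists_ruler (K : Kripke) (s y : K.State) (hy : y ∈ K.trans s)
    (hys : ∃ n, ReachIn K s n y) (hi : ∃ n, ReachIn K s n K.init) :
    ∃ f : K.State → K.State, f s = y ∧ K.IsPath (fun k => f^[k] K.init) ∧
      ∀ m, ∃ k, m ≤ k ∧ f^[k] K.init = s := by
  classical
  let rank : K.State → ℕ := fun t => sInf {n | ReachIn K s n t}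
  have hr1 : ∀ t, (∃ n, ReachIn K s n t) → ReachIn K s (rank t) t := fun t ht => Nat.sInf_mem ht
  have hr2 : ∀ t n, ReachIn K s n t → rank t ≤ n := fun t n h => Nat.sInf_le h
  have key : ∀ t, ∃ t', (∃ n, ReachIn K s n t) →
      (t' ∈ K.trans t ∧ (∃ n, ReachIn K s n t') ∧ (t = s → t' = y) ∧
        (t ≠ s → rank t' < rank t)) := by
    intro t
    by_cases ht : ∃ n, ReachIn K s n t
    · by_cases hts : t = s
      · exact ⟨y, fun _ => ⟨hts ▸ hy, hys, fun _ => rfl, fun h => absurd hts h⟩⟩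
      · have h1 := hr1 t ht
        rcases hm : rank t with _ | m
        · rw [hm] at h1; exact absurd h1 hts
        · rw [hm] at h1
          obtain ⟨t', ht', hR⟩ := h1
          exact ⟨t', fun _ => ⟨ht', ⟨m, hR⟩, fun h => absurd h hts,
            fun _ => by have := hr2 t' m hR; omega⟩⟩
    · exact ⟨t, fun h => absurd h ht⟩
  choose f hf using key
  have hco : ∀ k, ∃ n, ReachIn K s n (f^[k] K.init) := by
    intro k
    induction k with
    | zero => exact hi
    | succ k ih => rw [Function.iterate_succ_apply']; exact (hf _ ih).2.1
  refine ⟨f, (hf s ⟨0, rfl⟩).2.2.1 rfl, ⟨rfl, fun k => ?_⟩, fun m => ?_⟩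
  · simp only [Function.iterate_succ_apply']
    exact (hf _ (hco k)).1
  · have : ∀ d m, rank (f^[m] K.init) ≤ d → ∃ k, m ≤ k ∧ f^[k] K.init = s := by
      intro d
      induction d with
      | zero =>
        intro m hm
        refine ⟨m, le_rfl, ?_⟩
        have := hr1 _ (hco m)
        rw [Nat.le_zero.1 hm] at this
        exact this
      | succ d ih =>
        intro m hm
        by_cases hs : f^[m] K.init = s
        · exact ⟨m, le_rfl, hs⟩
        · obtain ⟨k, hk, hk'⟩ := ih (m + 1) (by
            rw [Function.iterate_succ_apply']
            have := (hf _ (hco m)).2.2.2 hs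
            omega)
          exact ⟨k, by omega, hk'⟩
    exact this _ m le_rfl

theorem row_key (K : Kripke) (β : ℕ → K.State) (s x : K.State)
    (hfun : ∀ a b n, β a = β b → β (a + n) = β (b + n))
    (hinf : ∀ m, ∃ k, m ≤ k ∧ β k = s)
    (hx : ∀ m, β m = s → β (m + 1) ≠ x)
    (S X : Set (List K.State))
    (hS : S = {v | ∃ a k, v = pre (fun j => β (a + j)) k ∧ β (a + k) = s})
    (hX : X = {v | ∃ p k, v = pre p k ∧ p k = x})
    (c i w : ℕ) (p p' : ℕ → K.State) (hp : Row K β S X c p) (hp' : Row K β S X i p')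
    (hag : ∀ j ≤ w, p j = p' j) (hi : i ≤ w) (hci : c < i) : False := by
  obtain ⟨⟨hp0, -⟩, n, hcn, ⟨hSn, hXn⟩, hmin⟩ := hp
  obtain ⟨⟨hp0', -⟩, n', hin', ⟨hSn', -⟩, -⟩ := hp'
  have hβ : β c = β i := by rw [← hp0, ← hp0']; exact hag 0 (by omega)
  have follow : ∀ (q : ℕ → K.State) (c n : ℕ), q 0 = β c → pre q n ∈ S →
      (∀ j ≤ n, q j = β (c + j)) ∧ β (c + n) = s := by
    intro q c n hq h
    rw [hS] at h
    obtain ⟨a, k, h1, h2⟩ := h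
    obtain ⟨rfl, h3⟩ := pre_inj.1 h1
    have h0 : β c = β a := by rw [← hq]; exact h3 0 (by omega)
    exact ⟨fun j hj => by rw [h3 j hj]; exact (hfun _ _ _ h0).symm, by rw [hfun _ _ _ h0]; exact h2⟩
  obtain ⟨f1, f2⟩ := follow p c n hp0 hSn
  obtain ⟨g1, g2⟩ := follow p' i n' hp0' hSn'
  have hxn : p (n + 1) = x := by
    rw [hX] at hXn
    obtain ⟨q, k, h1, h2⟩ := hXn
    obtain ⟨rfl, h3⟩ := pre_inj.1 h1
    rw [h3 _ le_rfl, h2]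
  have hni : n < i := by
    by_contra hni
    push Not at hni
    -- there is a visit to `s` in the window
    obtain ⟨m, hm1, hm2⟩ : ∃ m, (2 * c ≤ m ∧ β m = s) ∧ m < c + i := by
      classical
      have hex : ∃ m, 2 * c ≤ m ∧ β m = s := hinf (2 * c)
      refine ⟨Nat.find hex, Nat.find_spec hex, ?_⟩
      by_contra hlt
      push Not at hlt
      have hs := Nat.find_spec hex
      set m := Nat.find hex with hm
      have : 2 * c ≤ m - (i - c) ∧ β (m - (i - c)) = s := by
        refine ⟨by omega, ?_⟩
        have h1 := hfun c i (m - i) hβ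
        rw [show i + (m - i) = m by omega, show c + (m - i) = m - (i - c) by omega] at h1
        rw [h1]; exact hs.2
      have := Nat.find_min' hex this
      omega
    refine hmin (m - c) (by omega) (by omega) ?_
    rw [hS]
    refine ⟨c, m - c, pre_inj.2 ⟨rfl, fun j hj => f1 j (by omega)⟩, ?_⟩
    rw [show c + (m - c) = m by omega]; exact hm1.2
  have h1 : p' (n + 1) = x := by rw [← hag (n + 1) (by omega)]; exact hxn
  rw [g1 (n + 1) (by omega), ← hfun _ _ _ hβ] at h1
  exact hx (c + n) f2 h1

theorem AddSem.sound (K : Kripke) (r i w : ℕ) (h : AddSem K r i w) (σ : ℕ → K.State)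
    (hσ : K.IsPath σ) : σ w = σ (r + i) := by
  by_cases hf : ∀ a b, σ a = σ b → σ (a + 1) = σ (b + 1)
  · have hf' : ∀ n a b, σ a = σ b → σ (a + n) = σ (b + n) := by
      intro n
      induction n with
      | zero => intro a b h; exact h
      | succ n ih => intro a b h; exact hf _ _ (ih a b h)
    let E : Set (List K.State) := {v | ∃ c q, q 0 = σ c ∧ v = pre q (r + c)}
    have hfin : ∃ p, Row K σ Set.univ Set.univ i p ∧ i ≤ w ∧ pre p w ∈ E := by
      refine h σ hσ Set.univ Set.univ E ?_ ?_ ?_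
      · intro c
        obtain ⟨p, hp⟩ := exists_path K (σ c)
        exact ⟨p, hp, c, le_rfl, ⟨trivial, trivial⟩, fun k _ _ => by omega⟩
      · intro p hp
        exact ⟨0, p, hp.1.1, rfl⟩
      · rintro k c ⟨p, hp, hck, c1, q, hq, hpq⟩ p' hp'
        obtain ⟨rfl, h1⟩ := pre_inj.1 hpq
        have : σ c = σ c1 := by rw [← hq, ← hp.1.1]; exact (h1 0 (by omega))
        exact ⟨c1 + 1, p', by rw [hp'.1.1]; exact hf _ _ this, rfl⟩
    obtain ⟨p, hp, hiw, c, q, hq, hpq⟩ := hfin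
    obtain ⟨rfl, h1⟩ := pre_inj.1 hpq
    have : σ c = σ i := by rw [← hq, ← hp.1.1]; exact (h1 0 (by omega)).symm
    rw [Nat.add_comm r c, Nat.add_comm r i]
    exact hf' r _ _ this
  · push Not at hf
    obtain ⟨a, b, hab, hne, hlt⟩ : ∃ a b, σ a = σ b ∧ σ (a + 1) ≠ σ (b + 1) ∧ a < b := by
      obtain ⟨a, b, hab, hne⟩ := hf
      rcases lt_trichotomy a b with hl | rfl | hl
      · exact ⟨a, b, hab, hne, hl⟩
      · exact absurd rfl hne
      · exact ⟨b, a, hab.symm, hne.symm, hl⟩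
    obtain ⟨f, hfs, hβ, hinf⟩ := exists_ruler K (σ a) (σ (a + 1)) (hσ.2 a)
      ⟨b - (a + 1), by
        have := reachIn_path K σ hσ.2 (b - (a + 1)) (a + 1)
        rwa [show a + 1 + (b - (a + 1)) = b by omega, ← hab] at this⟩
      ⟨a, by
        have := reachIn_path K σ hσ.2 a 0
        rwa [Nat.zero_add, hσ.1] at this⟩
    set β : ℕ → K.State := fun k => f^[k] K.init with hβdef
    have hsucc : ∀ m, β (m + 1) = f (β m) := fun m => Function.iterate_succ_apply' f m K.init
    have hfun : ∀ a b n, β a = β b → β (a + n) = β (b + n) := by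
      intro a b n h
      induction n with
      | zero => exact h
      | succ n ih => rw [← Nat.add_assoc, ← Nat.add_assoc, hsucc, hsucc, ih]
    have hx : ∀ m, β m = σ a → β (m + 1) ≠ σ (b + 1) := by
      intro m hm
      rw [hsucc, hm, hfs]; exact hne
    let S : Set (List K.State) := {v | ∃ c k, v = pre (fun j => β (c + j)) k ∧ β (c + k) = σ a}
    let X : Set (List K.State) := {v | ∃ p k, v = pre p k ∧ p k = σ (b + 1)}
    have key : ∀ c i w p p', Row K β S X c p → Row K β S X i p' → (∀ j ≤ w, p j = p' j) →
        c ≤ w → i ≤ w → c = i := by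
      intro c i w p p' hp hp' hag hc hi
      rcases lt_trichotomy c i with hl | rfl | hl
      · exact (row_key K β (σ a) (σ (b + 1)) hfun hinf hx S X rfl rfl c i w p p' hp hp' hag hi hl).elim
      · rfl
      · exact (row_key K β (σ a) (σ (b + 1)) hfun hinf hx S X rfl rfl i c w p' p hp' hp
          (fun j hj => (hag j hj).symm) hc hl).elim
    let E : Set (List K.State) := {v | ∃ c q, Row K β S X c q ∧ v = pre q (r + c)}
    have hfin : ∃ p, Row K β S X i p ∧ i ≤ w ∧ pre p w ∈ E := by
      refine h β hβ S X E ?_ ?_ ?_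
      · intro c
        classical
        have hex : ∃ n, c ≤ n ∧ β (c + n) = σ a := by
          obtain ⟨k, hk, hk'⟩ := hinf (c + c)
          exact ⟨k - c, by omega, by rw [show c + (k - c) = k by omega]; exact hk'⟩
        obtain ⟨hn1, hn2⟩ := Nat.find_spec hex
        have hn3 : ∀ k, c ≤ k → k < Nat.find hex → β (c + k) ≠ σ a := fun k hk hlt he =>
          Nat.find_min hex hlt ⟨hk, he⟩
        generalize Nat.find hex = n at hn1 hn2 hn3
        obtain ⟨z, hz0, hz⟩ := exists_path K (σ (b + 1))
        have hpath : ∀ j ≤ n, (fun k => if k ≤ n then β (c + k) else z (k - (n + 1))) j = β (c + j) := by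
          intro j hj; simp [hj]
        refine ⟨fun k => if k ≤ n then β (c + k) else z (k - (n + 1)), ⟨by simp, fun k => ?_⟩,
          n, hn1, ⟨⟨c, n, pre_inj.2 ⟨rfl, hpath⟩, hn2⟩, ⟨_, n + 1, rfl, by simp [hz0]⟩⟩, ?_⟩
        · rcases lt_trichotomy k n with hl | rfl | hl
          · simp only [show k + 1 ≤ n by omega, show k ≤ n by omega, if_true]
            exact hβ.2 (c + k)
          · simp only [show ¬ (k + 1 ≤ k) by omega, le_rfl, if_true, if_false, Nat.sub_self, hz0, hn2]
            rw [hab]; exact hσ.2 b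
          · simp only [show ¬ (k + 1 ≤ n) by omega, show ¬ (k ≤ n) by omega, if_false]
            rw [show k + 1 - (n + 1) = (k - (n + 1)) + 1 by omega]
            exact hz _
        · rintro k hk hkn ⟨c', k', h1, h2⟩
          obtain ⟨rfl, h3⟩ := pre_inj.1 h1
          have h0 := h3 0 (by omega)
          simp only [Nat.zero_le, if_true, Nat.add_zero] at h0
          exact hn3 k hk hkn (by rw [hfun _ _ _ h0]; exact h2)
      · intro p hp
        exact ⟨0, p, hp, rfl⟩
      · rintro k c ⟨p, hp, hck, c1, q, hq, hpq⟩ p' hp'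
        obtain ⟨rfl, h1⟩ := pre_inj.1 hpq
        have := key c c1 _ p q hp hq h1 hck (by omega)
        subst this
        exact ⟨c + 1, p', hp', rfl⟩
    obtain ⟨p, hp, hiw, c, q, hq, hpq⟩ := hfin
    obtain ⟨rfl, h1⟩ := pre_inj.1 hpq
    rw [key i c _ p q hp hq h1 hiw (by omega)]

/-! ### Part 2: derived operators -/

namespace HQC

def and' (φ ψ : HQC) : HQC := .not (.or (.not φ) (.not ψ))
def imp (φ ψ : HQC) : HQC := .or (.not φ) ψ
def iff' (φ ψ : HQC) : HQC := and' (imp φ ψ) (imp ψ φ)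
def tt : HQC := .or (.atom 0 0) (.not (.atom 0 0))
def fut (φ : HQC) : HQC := .xuntil tt φ
def glob (φ : HQC) : HQC := .not (fut (.not φ))
def all (π : ℕ) (φ : HQC) : HQC := .not (.ex π (.not φ))
def pall (q : ℕ) (φ : HQC) : HQC := .not (.pex q (.not φ))
/-- `φ` holds at (some) position marked `q` on the reference path. -/
def atT (q : ℕ) (φ : HQC) : HQC := fut (and' (.atom q 0) φ)

section
variable {K : Kripke} {L : List K.State → Set ℕ} {Pi : ℕ → ℕ → K.State} {cur : ℕ → K.State}
  {i : ℕ} {φ ψ : HQC}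

theorem sat_atom {a v : ℕ} : Sat K L Pi cur i (.atom a v) ↔ a ∈ L (pre (Pi v) i) := Iff.rfl
theorem sat_not : Sat K L Pi cur i (.not φ) ↔ ¬ Sat K L Pi cur i φ := Iff.rfl
theorem sat_or : Sat K L Pi cur i (.or φ ψ) ↔ (Sat K L Pi cur i φ ∨ Sat K L Pi cur i ψ) := Iff.rfl
theorem sat_next : Sat K L Pi cur i (.next φ) ↔ Sat K L Pi cur (i + 1) φ := Iff.rfl
theorem sat_xuntil : Sat K L Pi cur i (.xuntil φ ψ) ↔ ∃ k, i ≤ k ∧ Sat K L Pi cur k ψ ∧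
    ∀ j, i ≤ j → j < k → Sat K L Pi cur j φ := Iff.rfl
theorem sat_ex {π : ℕ} : Sat K L Pi cur i (.ex π φ) ↔ ∃ p, K.PathFrom (cur i) p ∧
    Sat K L (Function.update Pi π p) p i φ := Iff.rfl
theorem sat_and : Sat K L Pi cur i (and' φ ψ) ↔ (Sat K L Pi cur i φ ∧ Sat K L Pi cur i ψ) := by
  simp only [and', Sat]; tauto
theorem sat_imp : Sat K L Pi cur i (imp φ ψ) ↔ (Sat K L Pi cur i φ → Sat K L Pi cur i ψ) := by
  simp only [imp, Sat]; tauto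
theorem sat_iff : Sat K L Pi cur i (iff' φ ψ) ↔ (Sat K L Pi cur i φ ↔ Sat K L Pi cur i ψ) := by
  simp only [iff', sat_and, sat_imp]; tauto
theorem sat_fut : Sat K L Pi cur i (fut φ) ↔ ∃ k, i ≤ k ∧ Sat K L Pi cur k φ := by
  simp only [fut, tt, Sat, em, implies_true, and_true]
theorem sat_glob : Sat K L Pi cur i (glob φ) ↔ ∀ k, i ≤ k → Sat K L Pi cur k φ := by
  simp only [glob, sat_not, sat_fut]; push Not; rfl
theorem sat_all {π : ℕ} : Sat K L Pi cur i (all π φ) ↔ ∀ p, K.PathFrom (cur i) p →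
    Sat K L (Function.update Pi π p) p i φ := by
  simp only [all, Sat]; push Not; rfl
end
end HQC

/-- Agreement of labelings on the propositions below `n`. -/
def AgrB {S : Type} (n : ℕ) (L L' : List S → Set ℕ) : Prop :=
  ∀ w, ∀ b < n, (b ∈ L' w ↔ b ∈ L w)

theorem AgrB.trans {S : Type} {n m : ℕ} {L L' L'' : List S → Set ℕ} (h : AgrB n L L')
    (h' : AgrB m L' L'') (hm : n ≤ m) : AgrB n L L'' :=
  fun w b hb => (h' w b (by omega)).trans (h w b hb)

def PropAt {S : Type} (L : List S → Set ℕ) (q : ℕ) (X : Set (List S)) : Prop :=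
  ∀ v, q ∈ L v ↔ v ∈ X

def TimeAt {S : Type} (L : List S → Set ℕ) (ρ : ℕ → S) (q t : ℕ) : Prop :=
  ∀ k, q ∈ L (pre ρ k) ↔ k = t

theorem PropAt.mono {S : Type} {L L' : List S → Set ℕ} {q n : ℕ} {X : Set (List S)}
    (h : PropAt L q X) (ha : AgrB n L L') (hq : q < n) : PropAt L' q X :=
  fun v => (ha v q hq).trans (h v)

theorem TimeAt.mono {S : Type} {L L' : List S → Set ℕ} {ρ : ℕ → S} {q t n : ℕ}
    (h : TimeAt L ρ q t) (ha : AgrB n L L') (hq : q < n) : TimeAt L' ρ q t :=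
  fun v => (ha _ q hq).trans (h v)

namespace HQC
section
variable {K : Kripke} {L : List K.State → Set ℕ} {Pi : ℕ → ℕ → K.State} {cur : ℕ → K.State}
  {i : ℕ} {φ ψ : HQC}

theorem sat_pex {q : ℕ} {P : Set (List K.State) → Prop}
    (h : ∀ X L', AgrB q L L' → PropAt L' q X → (Sat K L' Pi cur i φ ↔ P X)) :
    Sat K L Pi cur i (.pex q φ) ↔ ∃ X, P X := by
  simp only [Sat]
  constructor
  · rintro ⟨L', h1, h2⟩
    exact ⟨{v | q ∈ L' v}, (h _ L' (fun w b hb => h1 w b (by omega)) (fun _ => Iff.rfl)).1 h2⟩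
  · rintro ⟨X, hX⟩
    refine ⟨fun w => {b | (b = q ∧ w ∈ X) ∨ (b ≠ q ∧ b ∈ L w)}, ?_, ?_⟩
    · intro w b hb
      simp [hb]
    · refine (h X _ ?_ ?_).2 hX
      · intro w b hb
        simp [show b ≠ q by omega]
      · intro v
        simp

theorem sat_pall {q : ℕ} {P : Set (List K.State) → Prop}
    (h : ∀ X L', AgrB q L L' → PropAt L' q X → (Sat K L' Pi cur i φ ↔ P X)) :
    Sat K L Pi cur i (pall q φ) ↔ ∀ X, P X := by
  unfold pall
  rw [sat_not, sat_pex (P := fun X => ¬ P X)]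
  · push Not; rfl
  · intro X L' h1 h2
    rw [sat_not, h X L' h1 h2]

theorem sat_atT {q t : ℕ} (ht : TimeAt L (Pi 0) q t) :
    Sat K L Pi cur i (atT q φ) ↔ i ≤ t ∧ Sat K L Pi cur t φ := by
  simp only [atT, sat_fut, sat_and, sat_atom]
  constructor
  · rintro ⟨k, hk, h1, h2⟩
    obtain rfl := (ht k).1 h1
    exact ⟨hk, h2⟩
  · rintro ⟨h1, h2⟩
    exact ⟨t, h1, (ht t).2 rfl, h2⟩

def isTime1 (q : ℕ) : HQC :=
  .xuntil (.not (.atom q 0)) (and' (.atom q 0) (.next (glob (.not (.atom q 0)))))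
def exTime (q : ℕ) (φ : HQC) : HQC := .pex q (and' (isTime1 q) φ)
def allTime (q : ℕ) (φ : HQC) : HQC := .not (exTime q (.not φ))

theorem sat_isTime1 {q : ℕ} :
    Sat K L Pi cur 0 (isTime1 q) ↔ ∃ t, TimeAt L (Pi 0) q t := by
  simp only [isTime1, sat_xuntil, sat_and, sat_not, sat_next, sat_glob, sat_atom]
  constructor
  · rintro ⟨t, -, ⟨h1, h2⟩, h3⟩
    refine ⟨t, fun k => ⟨fun hk => ?_, fun hk => hk ▸ h1⟩⟩
    by_contra hne
    rcases lt_or_gt_of_ne hne with hl | hl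
    · exact h3 k (by omega) hl hk
    · exact h2 k (by omega) hk
  · rintro ⟨t, ht⟩
    refine ⟨t, by omega, ⟨(ht t).2 rfl, fun k hk h => ?_⟩, fun k _ hk h => ?_⟩
    · have := (ht k).1 h; omega
    · have := (ht k).1 h; omega

theorem sat_exTime {q : ℕ} {P : ℕ → Prop}
    (h : ∀ t L', AgrB q L L' → TimeAt L' (Pi 0) q t → (Sat K L' Pi cur 0 φ ↔ P t)) :
    Sat K L Pi cur 0 (exTime q φ) ↔ ∃ t, P t := by
  unfold exTime
  rw [sat_pex (P := fun X => ∃ t, (∀ k, pre (Pi 0) k ∈ X ↔ k = t) ∧ P t)]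
  · constructor
    · rintro ⟨X, t, -, h⟩
      exact ⟨t, h⟩
    · rintro ⟨t, h⟩
      refine ⟨{pre (Pi 0) t}, t, fun k => ?_, h⟩
      rw [Set.mem_singleton_iff, pre_inj]
      exact ⟨fun h => h.1, fun h => ⟨h, fun _ _ => rfl⟩⟩
  · intro X L' ha hX
    rw [sat_and, sat_isTime1]
    constructor
    · rintro ⟨⟨t, ht⟩, hs⟩
      exact ⟨t, fun k => (hX _).symm.trans (ht k), (h t L' ha ht).1 hs⟩
    · rintro ⟨t, ht, hs⟩
      have ht' : TimeAt L' (Pi 0) q t := fun k => (hX _).trans (ht k)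
      exact ⟨⟨t, ht'⟩, (h t L' ha ht').2 hs⟩

theorem sat_allTime {q : ℕ} {P : ℕ → Prop}
    (h : ∀ t L', AgrB q L L' → TimeAt L' (Pi 0) q t → (Sat K L' Pi cur 0 φ ↔ P t)) :
    Sat K L Pi cur 0 (allTime q φ) ↔ ∀ t, P t := by
  unfold allTime
  rw [sat_not, sat_exTime (P := fun t => ¬ P t)]
  · push Not; rfl
  · intro X L' h1 h2
    rw [sat_not, h X L' h1 h2]

/-! #### Addition formula -/

def chi (m : ℕ) : HQC :=
  .xuntil (.not (.atom m (m + 1))) (and' (.atom m (m + 1)) (.next (.atom (m + 1) (m + 1))))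

def addStep (m : ℕ) : HQC :=
  allTime (m + 3) (allTime (m + 4) (imp (atT (m + 3) (.next (.atom (m + 4) 0)))
    (glob (imp (.ex (m + 1) (and' (chi m) (atT (m + 3) (.atom (m + 2) (m + 1)))))
      (.next (all (m + 1) (imp (chi m) (atT (m + 4) (.atom (m + 2) (m + 1))))))))))

def addF (r i w m : ℕ) : HQC :=
  all m (pall m (pall (m + 1) (pall (m + 2)
    (imp (glob (.ex (m + 1) (chi m)))
      (imp (all (m + 1) (imp (chi m) (atT r (.atom (m + 2) (m + 1)))))
        (imp (addStep m)
          (atT i (.ex (m + 1) (and' (chi m) (atT w (.atom (m + 2) (m + 1))))))))))))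

theorem sat_chi {m c : ℕ} {S X : Set (List K.State)} {β p : ℕ → K.State}
    (hS : PropAt L m S) (hX : PropAt L (m + 1) X) (hp : K.PathFrom (β c) p) :
    Sat K L (Function.update Pi (m + 1) p) cur c (chi m) ↔ Row K β S X c p := by
  simp only [chi, sat_xuntil, sat_and, sat_not, sat_next, sat_atom, Function.update_self, Row]
  simp only [hS _, hX _, hp, true_and]

theorem row_ex {m c : ℕ} {S X : Set (List K.State)} {β : ℕ → K.State} {P : (ℕ → K.State) → Prop}
    (hS : PropAt L m S) (hX : PropAt L (m + 1) X)
    (h : ∀ p, Sat K L (Function.update Pi (m + 1) p) p c φ ↔ P p) :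
    Sat K L Pi β c (.ex (m + 1) (and' (chi m) φ)) ↔ ∃ p, Row K β S X c p ∧ P p := by
  rw [sat_ex]
  constructor
  · rintro ⟨p, hp, h1⟩
    rw [sat_and, sat_chi hS hX hp, h] at h1
    exact ⟨p, h1⟩
  · rintro ⟨p, h1⟩
    refine ⟨p, h1.1.1, ?_⟩
    rw [sat_and, sat_chi hS hX h1.1.1, h]
    exact h1

theorem row_all {m c : ℕ} {S X : Set (List K.State)} {β : ℕ → K.State} {P : (ℕ → K.State) → Prop}
    (hS : PropAt L m S) (hX : PropAt L (m + 1) X)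
    (h : ∀ p, Sat K L (Function.update Pi (m + 1) p) p c φ ↔ P p) :
    Sat K L Pi β c (all (m + 1) (imp (chi m) φ)) ↔ ∀ p, Row K β S X c p → P p := by
  rw [sat_all]
  constructor
  · intro h1 p hp
    have := h1 p hp.1
    rw [sat_imp, sat_chi hS hX hp.1, h] at this
    exact this hp
  · intro h1 p hp
    rw [sat_imp, sat_chi hS hX hp, h]
    exact h1 p

theorem sat_atE {m q t c : ℕ} {E : Set (List K.State)} (hE : PropAt L (m + 2) E)
    (ht : TimeAt L (Pi 0) q t) (p : ℕ → K.State) :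
    Sat K L (Function.update Pi (m + 1) p) cur c (atT q (.atom (m + 2) (m + 1))) ↔
      (c ≤ t ∧ pre p t ∈ E) := by
  rw [sat_atT (t := t), sat_atom, Function.update_self, hE]
  rwa [Function.update_of_ne (by omega)]

theorem sat_addStep {m : ℕ} {S X E : Set (List K.State)} {β : ℕ → K.State}
    (hS : PropAt L m S) (hX : PropAt L (m + 1) X) (hE : PropAt L (m + 2) E) :
    Sat K L Pi β 0 (addStep m) ↔ (∀ k c, (∃ p, Row K β S X c p ∧ c ≤ k ∧ pre p k ∈ E) →
      ∀ p, Row K β S X (c + 1) p → pre p (k + 1) ∈ E) := by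
  unfold addStep
  rw [sat_allTime (P := fun k => ∀ k', k + 1 = k' → ∀ c,
    (∃ p, Row K β S X c p ∧ c ≤ k ∧ pre p k ∈ E) →
      ∀ p, Row K β S X (c + 1) p → (c + 1 ≤ k' ∧ pre p k' ∈ E))]
  · constructor
    · intro h k c h1 p hp
      exact (h k _ rfl c h1 p hp).2
    · rintro h k _ rfl c h1 p hp
      refine ⟨?_, h k c h1 p hp⟩
      obtain ⟨_, _, h3, _⟩ := h1
      omega
  · intro k L1 a1 t1
    apply sat_allTime
    intro k' L2 a2 t2
    have t1' := t1.mono a2 (by omega)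
    have hS' := (hS.mono a1 (by omega)).mono a2 (by omega)
    have hX' := (hX.mono a1 (by omega)).mono a2 (by omega)
    have hE' := (hE.mono a1 (by omega)).mono a2 (by omega)
    rw [sat_imp, sat_atT t1', sat_next, sat_atom, t2, sat_glob]
    simp only [Nat.zero_le, true_and, forall_const]
    refine imp_congr Iff.rfl (forall_congr' fun c => ?_)
    rw [sat_imp, sat_next, row_ex hS' hX' (fun p => sat_atE hE' t1' p),
      row_all hS' hX' (fun p => sat_atE hE' t2 p)]

theorem sat_add {r i w m tr ti tw : ℕ} (hm : 0 < m) (hr : r < m) (hi : i < m) (hw : w < m)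
    (h0 : cur 0 = K.init) (htr : TimeAt L (Pi 0) r tr) (hti : TimeAt L (Pi 0) i ti)
    (htw : TimeAt L (Pi 0) w tw) :
    Sat K L Pi cur 0 (addF r i w m) ↔ AddSem K tr ti tw := by
  unfold addF AddSem
  rw [sat_all, h0]
  refine forall_congr' fun β => imp_congr Iff.rfl ?_
  apply sat_pall
  intro S L1 a1 hS
  apply sat_pall
  intro X L2 a2 hX
  apply sat_pall
  intro E L3 a3 hE
  have hX := hX.mono a3 (by omega)
  have hS := (hS.mono a2 (by omega)).mono a3 (by omega)
  have hP0 : Function.update Pi m β 0 = Pi 0 := Function.update_of_ne (by omega) _ _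
  have mono : ∀ q t, q < m → TimeAt L (Pi 0) q t → TimeAt L3 (Function.update Pi m β 0) q t := by
    intro q t hq ht
    rw [hP0]
    exact ((ht.mono a1 hq).mono a2 (by omega)).mono a3 (by omega)
  have htr := mono _ _ hr htr
  have hti := mono _ _ hi hti
  have htw := mono _ _ hw htw
  rw [sat_imp, sat_imp, sat_imp, sat_addStep hS hX hE, sat_atT hti, sat_glob,
    row_all hS hX (fun p => sat_atE hE htr p), row_ex hS hX (fun p => sat_atE hE htw p)]
  simp only [Nat.zero_le, true_and, forall_const]
  refine imp_congr (forall_congr' fun c => ?_) Iff.rfl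
  rw [sat_ex]
  constructor
  · rintro ⟨p, hp, h⟩
    exact ⟨p, (sat_chi hS hX hp).1 h⟩
  · rintro ⟨p, hp⟩
    exact ⟨p, hp.1, (sat_chi hS hX hp.1).2 hp⟩

def eqAt (v₁ v₂ t q : ℕ) : HQC := pall q (atT t (iff' (.atom q v₁) (.atom q v₂)))

theorem sat_eqAt {v₁ v₂ q t τ : ℕ} (ht : TimeAt L (Pi 0) t τ) (hq : t < q) :
    Sat K L Pi cur 0 (eqAt v₁ v₂ t q) ↔ ∀ j ≤ τ, Pi v₁ j = Pi v₂ j := by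
  unfold eqAt
  rw [sat_pall (P := fun X => (pre (Pi v₁) τ ∈ X ↔ pre (Pi v₂) τ ∈ X))]
  · constructor
    · intro h
      have := (h {pre (Pi v₂) τ}).2 rfl
      exact (pre_inj.1 this).2
    · intro h X
      rw [pre_inj.2 ⟨rfl, h⟩]
  · intro X L' ha hX
    rw [sat_atT (ht.mono ha hq), sat_iff, sat_atom, sat_atom, hX, hX]
    simp

def atomAt (a v r i n : ℕ) : HQC := exTime n (and' (addF r i n (n + 1)) (atT n (.atom a v)))

theorem sat_atomAt {a v r i n tr ti : ℕ} (hr : r < n) (hi : i < n) (ha : a < n)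
    (hL : ∀ w, a ∈ L w ↔ a ∈ K.seqLabel' w) (hv : K.IsPath (Pi v))
    (h0 : cur 0 = K.init) (htr : TimeAt L (Pi 0) r tr) (hti : TimeAt L (Pi 0) i ti) :
    Sat K L Pi cur 0 (atomAt a v r i n) ↔ a ∈ K.label (Pi v (tr + ti)) := by
  unfold atomAt
  rw [sat_exTime (P := fun w => AddSem K tr ti w ∧ a ∈ K.label (Pi v w))]
  · constructor
    · rintro ⟨w, h1, h2⟩
      rwa [← h1.sound K _ _ _ _ hv]
    · intro h
      exact ⟨_, AddSem.complete K tr ti, h⟩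
  · intro w L' hA htw
    rw [sat_and, sat_add (by omega) (by omega) (by omega) (by omega) h0 (htr.mono hA hr)
      (hti.mono hA hi) htw, sat_atT htw, sat_atom, hA _ _ ha, hL, seqLabel_pre]
    simp

def bigAnd {α : Type} (f : α → HQC) : List α → HQC
  | [] => tt
  | a :: l => and' (f a) (bigAnd f l)

theorem sat_bigAnd {α : Type} (f : α → HQC) (l : List α) :
    Sat K L Pi cur i (bigAnd f l) ↔ ∀ a ∈ l, Sat K L Pi cur i (f a) := by
  induction l with
  | nil => simp [bigAnd, tt, Sat, em]
  | cons a l ih => simp [bigAnd, sat_and, ih]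

end
end HQC

/-! ### Part 2: the translation -/

/-- Compile-time environment: path variables and time propositions. -/
structure Env where
  var : ℕ → ℕ
  tm : ℕ → ℕ
  cv : ℕ
  ct : ℕ
  now : ℕ

open HQC in
/-- Translation of HyperKCTL* into HyperQCTL*, fresh names starting at `n`. -/
noncomputable def tr : HKC → Env → ℕ → HQC
  | .atom a π, e, n => atomAt a (e.var π) (e.tm π) e.now n
  | .not φ, e, n => .not (tr φ e n)
  | .or φ ψ, e, n => .or (tr φ e n) (tr ψ e n)
  | .next φ, e, n =>
      exTime n (and' (atT e.now (.next (.atom n 0))) (tr φ { e with now := n } (n + 1)))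
  | .xuntil φ ψ, e, n =>
      exTime n (and' (atT e.now (atT n tt)) (and' (tr ψ { e with now := n } (n + 1))
        (allTime (n + 1) (imp (and' (atT e.now (atT (n + 1) tt)) (atT (n + 1) (.next (atT n tt))))
          (tr φ { e with now := n + 1 } (n + 2))))))
  | .ex π φ, e, n =>
      exTime n (and' (addF e.ct e.now n (n + 1)) (.ex (n + 1) (and' (eqAt (n + 1) e.cv n (n + 2))
        (tr φ { e with var := Function.update e.var π (n + 1), tm := Function.update e.tm π n,
                       cv := n + 1, ct := n } (n + 3)))))
  | .know A π φ, e, n =>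
      all n (imp (allTime n (imp (atT n (atT e.now tt))
          (bigAnd (fun a => iff' (atomAt a (e.var π) (e.tm π) n (n + 1)) (atT n (.atom a n))) A.toList)))
        (exTime n (and' (.atom n 0)
          (tr φ { e with var := Function.update e.var π n, tm := Function.update e.tm π n } (n + 1)))))

/-- Strict upper bound on the propositions of a formula. -/
def HKC.bd : HKC → ℕ
  | .atom a _ => a + 1
  | .not φ => φ.bd
  | .or φ ψ => max φ.bd ψ.bd
  | .next φ => φ.bd
  | .xuntil φ ψ => max φ.bd ψ.bd
  | .ex _ φ => φ.bd
  | .know A _ φ => max (A.sup (fun a => a + 1)) φ.bd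

structure Good (K : Kripke) (B n : ℕ) (e : Env) (L : List K.State → Set ℕ)
    (Pi : ℕ → ℕ → K.State) (cur : ℕ → K.State) (T : ℕ → ℕ) (tc ti : ℕ) : Prop where
  hB : B ≤ n
  hn : 0 < n
  var_lt : ∀ π, e.var π < n
  tm_lt : ∀ π, e.tm π < n
  cv_lt : e.cv < n
  ct_lt : e.ct < n
  now_lt : e.now < n
  lab : ∀ w, ∀ b < B, (b ∈ L w ↔ b ∈ K.seqLabel' w)
  cur0 : cur 0 = K.init
  pv : ∀ π, K.IsPath (Pi (e.var π))
  pc : K.IsPath (Pi e.cv)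
  tmT : ∀ π, TimeAt L (Pi 0) (e.tm π) (T π)
  ctT : TimeAt L (Pi 0) e.ct tc
  nowT : TimeAt L (Pi 0) e.now ti

theorem Good.mono {K : Kripke} {B n n' : ℕ} {e : Env} {L L' : List K.State → Set ℕ}
    {Pi Pi' : ℕ → ℕ → K.State} {cur cur' : ℕ → K.State} {T : ℕ → ℕ} {tc ti : ℕ}
    (g : Good K B n e L Pi cur T tc ti) (hn : n ≤ n') (hA : AgrB n L L')
    (hPi : ∀ v < n, Pi' v = Pi v) (hc : cur' 0 = K.init) :
    Good K B n' e L' Pi' cur' T tc ti where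
  hB := g.hB.trans hn
  hn := g.hn.trans_le hn
  var_lt π := (g.var_lt π).trans_le hn
  tm_lt π := (g.tm_lt π).trans_le hn
  cv_lt := g.cv_lt.trans_le hn
  ct_lt := g.ct_lt.trans_le hn
  now_lt := g.now_lt.trans_le hn
  lab w b hb := (hA w b (hb.trans_le g.hB)).trans (g.lab w b hb)
  cur0 := hc
  pv π := by rw [hPi _ (g.var_lt π)]; exact g.pv π
  pc := by rw [hPi _ g.cv_lt]; exact g.pc
  tmT π := by rw [hPi _ g.hn]; exact (g.tmT π).mono hA (g.tm_lt π)
  ctT := by rw [hPi _ g.hn]; exact g.ctT.mono hA g.ct_lt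
  nowT := by rw [hPi _ g.hn]; exact g.nowT.mono hA g.now_lt

open HQC in
theorem sat_tt {K : Kripke} {L : List K.State → Set ℕ} {Pi : ℕ → ℕ → K.State}
    {cur : ℕ → K.State} {i : ℕ} : Sat K L Pi cur i tt ↔ True := by
  simp [tt, Sat, em]

/-- Splicing a path onto a prefix. -/
theorem splice (K : Kripke) (σ p : ℕ → K.State) (w : ℕ) (hσ : K.IsPath σ)
    (hp : K.PathFrom (σ w) p) :
    ∃ σ', K.IsPath σ' ∧ (∀ j ≤ w, σ' j = σ j) ∧ (fun k => σ' (w + k)) = p := by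
  refine ⟨fun k => if k ≤ w then σ k else p (k - w), ⟨by simpa using hσ.1, fun k => ?_⟩,
    fun j hj => by simp [hj], ?_⟩
  · rcases lt_trichotomy k w with hl | rfl | hl
    · simp only [show k + 1 ≤ w by omega, show k ≤ w by omega, if_true]
      exact hσ.2 k
    · simp only [show ¬ (k + 1 ≤ k) by omega, le_rfl, if_true, if_false, Nat.add_sub_cancel_left]
      have := hp.2 0
      rwa [hp.1] at this
    · simp only [show ¬ (k + 1 ≤ w) by omega, show ¬ (k ≤ w) by omega, if_false]
      rw [show k + 1 - w = (k - w) + 1 by omega]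
      exact hp.2 _
  · funext k
    rcases k with _ | k
    · simp [hp.1]
    · simp

theorem env_update {K : Kripke} (Pi : ℕ → ℕ → K.State) (var T : ℕ → ℕ) (π v w : ℕ)
    (σ : ℕ → K.State) (hv : ∀ π, var π < v) :
    (fun π' k => Function.update Pi v σ (Function.update var π v π') (Function.update T π w π' + k))
      = Function.update (fun π k => Pi (var π) (T π + k)) π (fun k => σ (w + k)) := by
  funext π' k
  by_cases h : π' = π
  · subst h; simp
  · simp only [Function.update_of_ne h]
    rw [Function.update_of_ne (hv π').ne]

open HQC in
theorem tr_sat (K : Kripke) (B : ℕ) (φ : HKC) : φ.bd ≤ B → ∀ n e L Pi cur T tc ti,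
    Good K B n e L Pi cur T tc ti →
    (HQC.Sat K L Pi cur 0 (tr φ e n) ↔
      HKC.Sat K (fun π k => Pi (e.var π) (T π + k)) (fun k => Pi e.cv (tc + k)) ti φ) := by
  induction φ with
  | atom a π =>
    intro hb n e L Pi cur T tc ti g
    simp only [HKC.bd] at hb
    simp only [tr, HKC.Sat]
    exact sat_atomAt (g.tm_lt π) g.now_lt (by have := g.hB; omega) (fun w => g.lab w a (by omega))
      (g.pv π) g.cur0 (g.tmT π) g.nowT
  | not φ ih =>
    intro hb n e L Pi cur T tc ti g
    simp only [tr, HKC.Sat, sat_not]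
    rw [ih hb n e L Pi cur T tc ti g]
  | or φ ψ ih1 ih2 =>
    intro hb n e L Pi cur T tc ti g
    simp only [HKC.bd, max_le_iff] at hb
    simp only [tr, HKC.Sat, sat_or]
    rw [ih1 hb.1 n e L Pi cur T tc ti g, ih2 hb.2 n e L Pi cur T tc ti g]
  | next φ ih =>
    intro hb n e L Pi cur T tc ti g
    simp only [tr, HKC.Sat]
    rw [sat_exTime (P := fun t => ti + 1 = t ∧
      HKC.Sat K (fun π k => Pi (e.var π) (T π + k)) (fun k => Pi e.cv (tc + k)) t φ)]
    · simp
    · intro t L' hA ht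
      have g' := g.mono (Nat.le_succ n) hA (fun _ _ => rfl) g.cur0
      rw [sat_and, sat_atT g'.nowT, sat_next, sat_atom, ht, ih hb _ { e with now := n } _ _ _ T tc t
        { g' with now_lt := Nat.lt_succ_self n, nowT := ht }]
      simp
  | xuntil φ ψ ih1 ih2 =>
    intro hb n e L Pi cur T tc ti g
    simp only [HKC.bd, max_le_iff] at hb
    simp only [tr, HKC.Sat]
    apply sat_exTime
    intro t L' hA ht
    have g' := g.mono (Nat.le_succ n) hA (fun _ _ => rfl) g.cur0
    rw [sat_and, sat_and, sat_atT g'.nowT, sat_atT ht, sat_tt, ih2 hb.2 _ { e with now := n } _ _ _ T tc t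
        { g' with now_lt := Nat.lt_succ_self n, nowT := ht },
      sat_allTime (P := fun j => ti ≤ j → j < t →
        HKC.Sat K (fun π k => Pi (e.var π) (T π + k)) (fun k => Pi e.cv (tc + k)) j φ)]
    · simp
    · intro j L'' hA' hj
      have g'' := g'.mono (Nat.le_succ (n + 1)) hA' (fun _ _ => rfl) g'.cur0
      have ht' := ht.mono hA' (Nat.lt_succ_self n)
      rw [sat_imp, sat_and, sat_atT g''.nowT, sat_atT hj, sat_atT hj, sat_next, sat_atT ht',
        sat_tt, sat_tt, ih1 hb.1 _ { e with now := n + 1 } _ _ _ T tc j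
        { g'' with now_lt := Nat.lt_succ_self (n + 1), nowT := hj }]
      simp
  | ex π φ ih =>
    intro hb n e L Pi cur T tc ti g
    simp only [tr, HKC.Sat]
    rw [sat_exTime (P := fun w => AddSem K tc ti w ∧ ∃ σ, K.IsPath σ ∧ (∀ j ≤ w, σ j = Pi e.cv j) ∧
      HKC.Sat K (Function.update (fun π k => Pi (e.var π) (T π + k)) π (fun k => σ (w + k)))
        (fun k => σ (w + k)) ti φ)]
    · constructor
      · rintro ⟨w, h1, σ, hσ, h2, h3⟩
        refine ⟨fun k => σ (w + k), ⟨?_, fun k => hσ.2 (w + k)⟩, h3⟩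
        rw [← h1.sound K _ _ _ _ g.pc, ← h2 w le_rfl]
        rfl
      · rintro ⟨p, hp, h⟩
        obtain ⟨σ, h1, h2, h3⟩ := splice K (Pi e.cv) p (tc + ti) g.pc hp
        exact ⟨tc + ti, AddSem.complete K tc ti, σ, h1, h2, by rw [h3]; exact h⟩
    · intro w L' hA hw
      have g' := g.mono (Nat.le_succ n) hA (fun _ _ => rfl) g.cur0
      rw [sat_and, sat_add (Nat.succ_pos n) g'.ct_lt g'.now_lt (Nat.lt_succ_self n) g'.cur0
        g'.ctT g'.nowT hw, sat_ex, g.cur0]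
      refine and_congr Iff.rfl (exists_congr fun σ => and_congr_right fun hσ => ?_)
      have hP0 : Function.update Pi (n + 1) σ 0 = Pi 0 := Function.update_of_ne (by omega) _ _
      have hw' : TimeAt L' (Function.update Pi (n + 1) σ 0) n w := by rw [hP0]; exact hw
      rw [sat_and, sat_eqAt hw' (by omega), Function.update_self,
        Function.update_of_ne (a := e.cv) (by have := g.cv_lt; omega)]
      refine and_congr Iff.rfl ?_
      have hupd : ∀ v < n + 1, Function.update Pi (n + 1) σ v = Pi v := fun v hv =>
        Function.update_of_ne (by omega) _ _
      have g2 := g'.mono (show n + 1 ≤ n + 3 by omega) (fun _ _ _ => Iff.rfl) hupd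
        (cur' := σ) hσ.1
      rw [ih hb _ ⟨Function.update e.var π (n + 1), Function.update e.tm π n, n + 1, n, e.now⟩
        _ _ _ (Function.update T π w) w ti
        { g2 with
          var_lt := fun π' => by
            by_cases h : π' = π
            · subst h; simp
            · simp only [Function.update_of_ne h]; exact g2.var_lt π'
          tm_lt := fun π' => by
            by_cases h : π' = π
            · subst h; simp
            · simp only [Function.update_of_ne h]; exact g2.tm_lt π'
          cv_lt := by simp
          ct_lt := by simp
          pv := fun π' => by
            by_cases h : π' = π
            · subst h; simpa [Kripke.IsPath] using hσ
            · simp only [Function.update_of_ne h]; exact g2.pv π'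
          pc := by simpa [Kripke.IsPath] using hσ
          tmT := fun π' => by
            by_cases h : π' = π
            · subst h; simpa only [Function.update_self] using hw'
            · simp only [Function.update_of_ne h]; exact g2.tmT π'
          ctT := hw' }]
      rw [env_update Pi e.var T π (n + 1) w σ g'.var_lt]
      simp only [Function.update_self]
  | know A π φ ih =>
    intro hb n e L Pi cur T tc ti g
    simp only [HKC.bd, max_le_iff] at hb
    simp only [tr, HKC.Sat]
    rw [sat_all, g.cur0]
    refine forall_congr' fun σ => imp_congr_right fun hσ => ?_
    have hupd : ∀ v < n, Function.update Pi n σ v = Pi v := fun v hv =>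
      Function.update_of_ne (by omega) _ _
    have g1 := g.mono (le_refl n) (fun _ _ _ => Iff.rfl) hupd (cur' := σ) hσ.1
    rw [sat_imp]
    refine imp_congr ?_ ?_
    · rw [sat_allTime (P := fun j => j ≤ ti → ∀ a ∈ A,
        (a ∈ K.label (Pi (e.var π) (T π + j)) ↔ a ∈ K.label (σ j)))]
      · exact ⟨fun h a ha j hj => h j hj a ha, fun h j hj a ha => h a ha j hj⟩
      · intro j L' hA hj
        have g2 := g1.mono (Nat.le_succ n) hA (fun _ _ => rfl) g1.cur0
        rw [sat_imp, sat_atT hj, sat_atT g2.nowT, sat_tt, sat_bigAnd]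
        simp only [Nat.zero_le, true_and, and_true, Finset.mem_toList]
        refine imp_congr_right fun _ => forall_congr' fun a => imp_congr_right fun ha => ?_
        have hab : a < B := by
          have : a + 1 ≤ A.sup (fun a => a + 1) := Finset.le_sup (f := fun a => a + 1) ha
          omega
        rw [sat_iff, sat_atomAt (g2.tm_lt π) (Nat.lt_succ_self n) (by have := g2.hB; omega)
          (fun w => g2.lab w a hab) (g2.pv π) g2.cur0 (g2.tmT π) hj, sat_atT hj, sat_atom,
          g2.lab _ a hab, seqLabel_pre, Function.update_self, hupd _ (g.var_lt π)]
        simp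
    · rw [sat_exTime (P := fun t => 0 = t ∧ HKC.Sat K
        (Function.update (fun π k => Pi (e.var π) (T π + k)) π (fun k => σ (t + k)))
        (fun k => Pi e.cv (tc + k)) ti φ)]
      · simp
      · intro t L' hA ht
        have g2 := g1.mono (Nat.le_succ n) hA (fun _ _ => rfl) g1.cur0
        rw [sat_and, sat_atom, ht, ih hb.2 _ { e with var := Function.update e.var π n, tm := Function.update e.tm π n }
          _ _ _ (Function.update T π t) tc ti
          { g2 with
            var_lt := fun π' => by
              by_cases h : π' = π
              · subst h; simp
              · simp only [Function.update_of_ne h]; exact g2.var_lt π'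
            tm_lt := fun π' => by
              by_cases h : π' = π
              · subst h; simp
              · simp only [Function.update_of_ne h]; exact g2.tm_lt π'
            pv := fun π' => by
              by_cases h : π' = π
              · subst h; simpa [Kripke.IsPath] using hσ
              · simp only [Function.update_of_ne h]; exact g2.pv π'
            tmT := fun π' => by
              by_cases h : π' = π
              · subst h; simpa only [Function.update_self] using ht
              · simp only [Function.update_of_ne h]; exact g2.tmT π' }]
        rw [env_update Pi e.var T π n t σ g.var_lt, hupd _ g.cv_lt]

/-! ### Part 2: sentences -/

theorem hqc_guarded_true (φ : HQC) : φ.Guarded true := by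
  induction φ <;> simp_all [HQC.Guarded]

/-- Bind the variables `1, …, N`. -/
def wrap (φ : HQC) : ℕ → HQC
  | 0 => φ
  | N + 1 => .ex (N + 1) (wrap φ N)

theorem wrap_free (φ : HQC) (N v : ℕ) (h : v ∈ (wrap φ N).free) :
    v ∈ φ.free ∧ (v = 0 ∨ N < v) := by
  induction N with
  | zero => exact ⟨h, by omega⟩
  | succ N ih =>
    simp only [wrap, HQC.free, Finset.mem_sdiff, Finset.mem_singleton] at h
    obtain ⟨h1, h2⟩ := ih h.1
    exact ⟨h1, by omega⟩

theorem wrap_sat (K : Kripke) (L : List K.State → Set ℕ) (φ : HQC) (P : Prop)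
    (h : ∀ Pi cur, K.IsPath (Pi 0) → cur 0 = K.init → (HQC.Sat K L Pi cur 0 φ ↔ P)) (N : ℕ) :
    ∀ Pi cur, K.IsPath (Pi 0) → cur 0 = K.init → (HQC.Sat K L Pi cur 0 (wrap φ N) ↔ P) := by
  induction N with
  | zero => exact h
  | succ N ih =>
    intro Pi cur h1 h2
    rw [wrap, HQC.sat_ex, h2]
    constructor
    · rintro ⟨p, hp, hs⟩
      exact (ih _ _ (by rwa [Function.update_of_ne (by omega)]) hp.1).1 hs
    · intro hP
      obtain ⟨p, hp⟩ := exists_path K K.init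
      exact ⟨p, hp, (ih _ _ (by rwa [Function.update_of_ne (by omega)]) hp.1).2 hP⟩

theorem hkc_free_congr (K : Kripke) (φ : HKC) : ∀ Pi Pi' cur i, (∀ v ∈ φ.free, Pi v = Pi' v) →
    (HKC.Sat K Pi cur i φ ↔ HKC.Sat K Pi' cur i φ) := by
  have upd : ∀ (Pi Pi' : ℕ → ℕ → K.State) (π : ℕ) (p : ℕ → K.State) (s : Finset ℕ),
      (∀ v ∈ s, v ≠ π → Pi v = Pi' v) →
      ∀ v ∈ s, Function.update Pi π p v = Function.update Pi' π p v := by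
    intro Pi Pi' π p s h v hv
    by_cases hvp : v = π
    · subst hvp; simp
    · simp only [Function.update_of_ne hvp]; exact h v hv hvp
  induction φ with
  | atom a π => intro Pi Pi' cur i h; simp only [HKC.Sat, h π (by simp [HKC.free])]
  | not φ ih => intro Pi Pi' cur i h; simp only [HKC.Sat]; rw [ih _ _ _ _ h]
  | or φ ψ ih1 ih2 =>
    intro Pi Pi' cur i h; simp only [HKC.Sat]
    simp only [HKC.free, Finset.mem_union] at h
    rw [ih1 _ _ _ _ (fun v hv => h v (.inl hv)), ih2 _ _ _ _ (fun v hv => h v (.inr hv))]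
  | next φ ih => intro Pi Pi' cur i h; simp only [HKC.Sat]; rw [ih _ _ _ _ h]
  | xuntil φ ψ ih1 ih2 =>
    intro Pi Pi' cur i h; simp only [HKC.Sat]
    simp only [HKC.free, Finset.mem_union] at h
    simp only [fun k => ih1 _ _ cur k (fun v hv => h v (.inl hv)),
      fun k => ih2 _ _ cur k (fun v hv => h v (.inr hv))]
  | ex π φ ih =>
    intro Pi Pi' cur i h; simp only [HKC.Sat]
    simp only [HKC.free, Finset.mem_sdiff, Finset.mem_singleton] at h
    refine exists_congr fun p => and_congr Iff.rfl (ih _ _ _ _ ?_)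
    exact upd _ _ _ _ _ fun v hv hne => h v ⟨hv, hne⟩
  | know A π φ ih =>
    intro Pi Pi' cur i h; simp only [HKC.Sat]
    simp only [HKC.free, Finset.mem_insert] at h
    rw [h π (.inl rfl)]
    refine forall_congr' fun p => imp_congr Iff.rfl (imp_congr Iff.rfl (ih _ _ _ _ ?_))
    exact upd _ _ _ _ _ fun v hv _ => h v (.inr hv)

theorem hkc_cur_congr (K : Kripke) (φ : HKC) : φ.Guarded false → ∀ Pi cur cur', cur 0 = cur' 0 →
    (HKC.Sat K Pi cur 0 φ ↔ HKC.Sat K Pi cur' 0 φ) := by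
  induction φ with
  | atom a π => intro _ Pi cur cur' h; simp only [HKC.Sat]
  | not φ ih => intro hg Pi cur cur' h; simp only [HKC.Sat]; rw [ih hg _ _ _ h]
  | or φ ψ ih1 ih2 =>
    intro hg Pi cur cur' h; simp only [HKC.Sat]; rw [ih1 hg.1 _ _ _ h, ih2 hg.2 _ _ _ h]
  | next φ ih => intro hg; exact absurd hg.1 (by simp)
  | xuntil φ ψ ih1 ih2 => intro hg; exact absurd hg.1 (by simp)
  | ex π φ ih => intro hg Pi cur cur' h; simp only [HKC.Sat, h]
  | know A π φ ih =>
    intro hg Pi cur cur' h; simp only [HKC.Sat]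
    exact forall_congr' fun p => imp_congr Iff.rfl (imp_congr Iff.rfl (ih hg _ _ _ h))

open HQC in
theorem part2 (φ : HKC) (hφ : φ.Sentence) :
    ∃ ψ : HQC, ψ.Sentence ∧ ∀ K : Kripke, (K.ModelsK φ ↔ K.ModelsQ ψ) := by
  let q := φ.bd
  let e : Env := { var := fun _ => 0, tm := fun _ => q, cv := 0, ct := q, now := q }
  let core : HQC := exTime q (and' (.atom q 0) (tr φ e (q + 1)))
  let N := core.free.sup id
  refine ⟨.ex 0 (wrap core N), ⟨?_, hqc_guarded_true _⟩, fun K => ?_⟩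
  · rw [Finset.eq_empty_iff_forall_notMem]
    intro v hv
    simp only [HQC.free, Finset.mem_sdiff, Finset.mem_singleton] at hv
    obtain ⟨h1, h2⟩ := wrap_free core N v hv.1
    have h3 : id v ≤ N := Finset.le_sup (f := id) h1
    simp only [id] at h3
    omega
  · have key : ∀ Pi cur, K.IsPath (Pi 0) → cur 0 = K.init →
        (HQC.Sat K K.seqLabel' Pi cur 0 core ↔ K.ModelsK φ) := by
      intro Pi cur h1 h2
      have hQ : HQC.Sat K K.seqLabel' Pi cur 0 core ↔ ∃ t, 0 = t ∧
          HKC.Sat K (fun _ k => Pi 0 (t + k)) (fun k => Pi 0 (t + k)) t φ := by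
        apply sat_exTime
        intro t L' hA ht
        rw [sat_and, sat_atom, ht, tr_sat K φ.bd φ le_rfl (q + 1) e L' Pi cur (fun _ => t) t t
          { hB := Nat.le_succ _, hn := Nat.succ_pos _, var_lt := fun _ => Nat.succ_pos _,
            tm_lt := fun _ => Nat.lt_succ_self _, cv_lt := Nat.succ_pos _,
            ct_lt := Nat.lt_succ_self _, now_lt := Nat.lt_succ_self _,
            lab := hA, cur0 := h2, pv := fun _ => h1, pc := h1, tmT := fun _ => ht,
            ctT := ht, nowT := ht }]
      rw [hQ]
      simp only [exists_eq_left', Nat.zero_add]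
      unfold Kripke.ModelsK
      rw [hkc_cur_congr K φ hφ.2 _ (fun k => Pi 0 k) (fun _ => K.init) h1.1]
      apply hkc_free_congr
      intro v hv
      rw [hφ.1] at hv
      exact absurd hv (Finset.notMem_empty v)
    have hw := wrap_sat K K.seqLabel' core _ key N
    unfold Kripke.ModelsQ
    rw [HQC.sat_ex]
    constructor
    · intro h
      obtain ⟨p, hp⟩ := exists_path K K.init
      exact ⟨p, hp, (hw _ _ (by rwa [Function.update_self]) hp.1).2 h⟩
    · rintro ⟨p, hp, hs⟩
      exact (hw _ _ (by rwa [Function.update_self]) hp.1).1 hs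

/-- **HyperQCTL* is strictly more expressive than HyperCTL*** over Kripke
structures: every HyperCTL* sentence is (via the syntactic embedding) a
HyperQCTL* sentence with the same models, the knowledge operator of
HyperKCTL* is expressible in HyperQCTL*, but some HyperQCTL* sentence has no
HyperCTL* equivalent. -/
theorem hyperQCTLstar_strictly_more_expressive_than_hyperCTLstar :
    (∀ φ : HCTL, φ.Sentence →
        φ.toHQC.Sentence ∧ ∀ K : Kripke, (K.ModelsC φ ↔ K.ModelsQ φ.toHQC)) ∧
    (∀ φ : HKC, φ.Sentence →
        ∃ ψ : HQC, ψ.Sentence ∧ ∀ K : Kripke, (K.ModelsK φ ↔ K.ModelsQ ψ)) ∧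
    (∃ ψ : HQC, ψ.Sentence ∧
        ¬ ∃ φ : HCTL, φ.Sentence ∧
            ∀ K : Kripke, (K.ModelsC φ ↔ K.ModelsQ ψ)) := by
  refine ⟨fun φ hφ => ⟨⟨?_, ?_⟩, fun K => toHQC_sat K φ _ _ _⟩, part2, psi3, psi3_sentence, ?_⟩
  · rw [toHQC_free]; exact hφ.1
  · rw [toHQC_guarded]; exact hφ.2
  · rintro ⟨φ, -, h⟩
    apply psi3_K1
    rw [← h]
    have h2 := (h K2).2 psi3_K2
    exact (unlabeled_sat K1 K2 (fun _ => rfl) (fun _ => rfl) φ _ _ _ _ _).2 h2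
end
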